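/- Let d ≥ 2, let {r_n} ⊂ (0,1) with r_n → 0⁺ and {s_n} ⊂ (1,+∞) with s_n → 1⁺, and let E ⊆ ℝ^d be a bounded open set with compact C² boundary. Then lim_{n→∞} J̃_{r_n}^{s_n}(E)/β(r_n, s_n) = ω_{d−1}·H^{d−1}(∂E), where H^{d−1} is the (d−1)-dimensional Hausdorff measure (equal to the De Giorgi perimeter of E for such sets). -/

import Mathlib

open MeasureTheory Filter Set Metric
open scoped ENNReal NNReal symmDiff

noncomputable section

abbrev Euc (d : ℕ) : Type := EuclideanSpace ℝ (Fin d)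

/-- The kernel `k^s_r`. -/
def ker (d : ℕ) (s r t : ℝ) : ℝ :=
  if t ≤ r then r ^ (-((d : ℝ) + s)) else t ^ (-((d : ℝ) + s))

/-- The regularized `s`-fractional perimeter `J̃_r^s(E) = ∫_E ∫_{Eᶜ} k^s_r(|x-y|) dy dx`. -/
def Jt (d : ℕ) (s r : ℝ) (E : Set (Euc d)) : ℝ≥0∞ :=
  ∫⁻ x in E, ∫⁻ y in Eᶜ, ENNReal.ofReal (ker d s r (dist x y))

/-- The scaling factor `σ^s(r)`. -/
def sgm (d : ℕ) (s r : ℝ) : ℝ :=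
  if s = 1 then |Real.log r| else (((d : ℝ) + s) / ((d : ℝ) + 1)) * r ^ (1 - s) / (s - 1)

/-- The scaling factor `β(r,s)` for the simultaneous limit. -/
def betaScale (d : ℕ) (s r : ℝ) : ℝ :=
  (((d : ℝ) + s) / ((d : ℝ) + 1)) * ((r ^ (1 - s) - 1) / (s - 1)) + 1 / ((d : ℝ) + 1)

/-- `ω_k`: Lebesgue measure of the unit ball in `ℝ^k`. -/
def omegaB (k : ℕ) : ℝ := (volume (ball (0 : Euc k) 1)).toReal

/-- Divergence of a vector field on `ℝ^d`. -/
def diverg {d : ℕ} (Φ : Euc d → Euc d) (x : Euc d) : ℝ :=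
  ∑ i : Fin d, fderiv ℝ Φ x (EuclideanSpace.single i 1) i

/-- De Giorgi perimeter. -/
def Per (d : ℕ) (E : Set (Euc d)) : ℝ≥0∞ :=
  ⨆ (Φ : Euc d → Euc d) (_ : ContDiff ℝ 1 Φ) (_ : HasCompactSupport Φ)
    (_ : ∀ x, ‖Φ x‖ ≤ 1), ENNReal.ofReal (∫ x in E, diverg Φ x)

/-- The cube `lQ + ξ` where `Q = [-1/2, 1/2)^d`. -/
def cube (d : ℕ) (l : ℝ) (ξ : Euc d) : Set (Euc d) :=
  {x | ∀ i, x i ∈ Set.Ico (ξ i - l / 2) (ξ i + l / 2)}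

/-- Half space `H⁻_ν(0)`. -/
def Hminus (d : ℕ) (ν : Euc d) : Set (Euc d) := {y | @inner ℝ _ _ ν y ≤ 0}

/-- Standard (normalized) `k`-dimensional Hausdorff measure on `ℝ^d`:
Mathlib's `μH[k]` uses `diam^k` gauges without the normalizing constant `ω_k/2^k`. -/
def Hstd (d : ℕ) (k : ℕ) : Measure (Euc d) :=
  (ENNReal.ofReal (omegaB k / 2 ^ k)) • (μH[(k : ℝ)] : Measure (Euc d))

/-- The nonlocal `k^s_r`-curvature. -/
def curv (d : ℕ) (s r : ℝ) (E : Set (Euc d)) (x : Euc d) : ℝ :=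
  ∫ y, (Set.indicator Eᶜ (fun _ => (1 : ℝ)) y - Set.indicator E (fun _ => (1 : ℝ)) y)
    * ker d s r (dist x y)

/-- The class `𝔈`: closures of open sets with compact `C²` boundary. -/
def IsC2Domain (d : ℕ) (E : Set (Euc d)) : Prop :=
  ∃ U : Set (Euc d), IsOpen U ∧ E = closure U ∧ IsCompact (frontier U) ∧
    ∃ f : Euc d → ℝ, ContDiff ℝ 2 f ∧ U = {x | f x < 0} ∧ frontier U = {x | f x = 0} ∧
      ∀ x ∈ frontier U, fderiv ℝ f x ≠ 0

/-- A bounded open set with compact `C²` boundary, encoded via a global `C²` defining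
function that is nondegenerate on the boundary. -/
structure BddC2Domain (d : ℕ) (E : Set (Euc d)) : Prop where
  isOpen : IsOpen E
  bounded : Bornology.IsBounded E
  defining : ∃ f : Euc d → ℝ, ContDiff ℝ 2 f ∧ E = {x | f x < 0} ∧
    frontier E = {x | f x = 0} ∧ ∀ x ∈ frontier E, fderiv ℝ f x ≠ 0

lemma bm1_compact {A B : Set ℝ} (hA : IsCompact A) (hB : IsCompact B) (hA0 : A.Nonempty)
    (hB0 : B.Nonempty) {C : Set ℝ} (h : ∀ a ∈ A, ∀ b ∈ B, (a + b) / 2 ∈ C) :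
    volume A + volume B ≤ 2 * volume C := by
  obtain ⟨a1, ha1, ha1'⟩ := hA.exists_isGreatest hA0
  obtain ⟨b0, hb0, hb0'⟩ := hB.exists_isLeast hB0
  have h1 : (fun x => b0 + x) '' A ∪ (fun x => a1 + x) '' B ⊆ (fun x => 2 * x) '' C := by
    rintro _ (⟨x, hx, rfl⟩ | ⟨x, hx, rfl⟩)
    · exact ⟨_, h x hx b0 hb0, by simp only; ring⟩
    · exact ⟨_, h a1 ha1 x hx, by simp only; ring⟩
  have h2 : volume ((fun x => 2 * x) '' C) = 2 * volume C := by
    have := Measure.addHaar_image_linearMap (volume : Measure ℝ) ((2:ℝ) • LinearMap.id) C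
    simpa using this
  have hd : AEDisjoint volume ((fun x => b0 + x) '' A) ((fun x => a1 + x) '' B) := by
    refine measure_mono_null (t := {a1 + b0}) ?_ (by simp)
    rintro _ ⟨⟨x, hx, rfl⟩, ⟨y, hy, hxy⟩⟩
    have := ha1' hx
    have := hb0' hy
    simp only [mem_singleton_iff] at *
    linarith
  rw [← h2]
  refine le_trans (le_of_eq ?_) (measure_mono h1)
  rw [measure_union₀ _ hd]
  · rw [Set.image_add_left, Set.image_add_left, measure_preimage_add, measure_preimage_add]
  · exact (hB.image (by fun_prop)).measurableSet.nullMeasurableSet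

lemma bm1 {A B : Set ℝ} (hA : MeasurableSet A) (hB : MeasurableSet B) (hA0 : A.Nonempty)
    (hB0 : B.Nonempty) {C : Set ℝ} (h : ∀ a ∈ A, ∀ b ∈ B, (a + b) / 2 ∈ C) :
    volume A + volume B ≤ 2 * volume C := by
  obtain ⟨a, ha⟩ := hA0
  obtain ⟨b, hb⟩ := hB0
  have key : ∀ K ⊆ A, IsCompact K → ∀ L ⊆ B, IsCompact L → volume K + volume L ≤ 2 * volume C := by
    intro K hK hKc L hL hLc
    have := bm1_compact (hKc.insert a) (hLc.insert b) ⟨a, by simp⟩ ⟨b, by simp⟩ (C := C)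
      (fun x hx y hy => h x (by rcases hx with rfl | hx; exacts [ha, hK hx]) y
        (by rcases hy with rfl | hy; exacts [hb, hL hy]))
    exact le_trans (add_le_add (measure_mono (subset_insert _ _))
      (measure_mono (subset_insert _ _))) this
  have k2 : ∀ L ⊆ B, IsCompact L → volume A + volume L ≤ 2 * volume C := by
    intro L hL hLc
    have : volume A ≤ 2 * volume C - volume L := by
      rw [hA.measure_eq_iSup_isCompact]
      refine iSup_le fun K => iSup_le fun hK => iSup_le fun hKc => ?_
      exact ENNReal.le_sub_of_add_le_right hLc.measure_lt_top.ne (key K hK hKc L hL hLc)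
    refine le_trans (add_le_add this le_rfl) ?_
    rw [tsub_add_cancel_of_le]
    exact le_trans le_add_self (key ∅ (by simp) isCompact_empty L hL hLc)
  by_cases hAt : volume A = ∞
  · have := k2 ∅ (by simp) isCompact_empty
    rw [hAt] at this ⊢
    simpa using this
  · have : volume B ≤ 2 * volume C - volume A := by
      rw [hB.measure_eq_iSup_isCompact]
      refine iSup_le fun K => iSup_le fun hK => iSup_le fun hKc => ?_
      refine ENNReal.le_sub_of_add_le_left hAt (k2 K hK hKc)
    refine le_trans (add_le_add le_rfl this) ?_
    rw [add_tsub_cancel_of_le]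
    simpa using k2 ∅ (by simp) isCompact_empty

/-- layer cake for functions bounded by one -/
lemma layer01 {f : ℝ → ℝ≥0∞} (hf : Measurable f) (h1 : ∀ x, f x ≤ 1) :
    ∫⁻ x, f x = ∫⁻ t in Ioo (0:ℝ) 1, volume {x | ENNReal.ofReal t < f x} := by
  have h0 : ∀ x, f x ≠ ∞ := fun x => ne_top_of_le_ne_top (by simp) (h1 x)
  have := lintegral_eq_lintegral_meas_lt (volume : Measure ℝ) (f := fun x => (f x).toReal)
    (Eventually.of_forall fun x => ENNReal.toReal_nonneg) (hf.ennreal_toReal.aemeasurable)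
  simp only [ENNReal.ofReal_toReal (h0 _)] at this
  rw [this]
  have e : ∀ t ∈ Ioi (0:ℝ), volume {a | t < (f a).toReal} =
     (Ioo (0:ℝ) 1).indicator (fun t => volume {x | ENNReal.ofReal t < f x}) t := by
    intro t ht
    by_cases h : t < 1
    · rw [indicator_of_mem (show t ∈ Ioo (0:ℝ) 1 from ⟨ht, h⟩)]
      congr 1
      ext x
      simp only [mem_ofPred_eq]
      rw [ENNReal.ofReal_lt_iff_lt_toReal (le_of_lt ht) (h0 x)]
    · rw [indicator_of_notMem (fun hh => h hh.2)]
      have : {a | t < (f a).toReal} = ∅ := by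
        ext x
        simp only [mem_ofPred_eq, mem_empty_iff_false, iff_false, not_lt]
        have : (f x).toReal ≤ 1 := ENNReal.toReal_le_of_le_ofReal (by simp) (by simpa using h1 x)
        linarith
      simp [this]
  rw [setLIntegral_congr_fun measurableSet_Ioi e, setLIntegral_indicator measurableSet_Ioo]
  congr 2
  ext x; simp +contextual

lemma pl1_norm {f g h : ℝ → ℝ≥0∞} (hf : Measurable f) (hg : Measurable g) (hh : Measurable h)
    (hF : ⨆ x, f x = 1) (hG : ⨆ x, g x = 1)
    (H : ∀ x y, f x * g y ≤ h ((x + y) / 2) ^ 2) :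
    (∫⁻ x, f x) * ∫⁻ x, g x ≤ (∫⁻ x, h x) ^ 2 := by
  have key : (∫⁻ x, f x) + ∫⁻ x, g x ≤ 2 * ∫⁻ x, h x := by
    have hm : ∫⁻ x, min (h x) 1 ≤ ∫⁻ x, h x := lintegral_mono fun x => min_le_left _ _
    refine le_trans ?_ (mul_le_mul_right hm 2)
    rw [layer01 hf (fun x => hF ▸ le_iSup f x), layer01 hg (fun x => hG ▸ le_iSup g x),
      layer01 (hh.min measurable_const) (fun x => min_le_right _ _), 
      ← lintegral_const_mul' _ _ (by simp)]
    have mono : ∀ f : ℝ → ℝ≥0∞, Measurable fun t : ℝ => volume {x | ENNReal.ofReal t < f x} := by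
      intro f
      refine Antitone.measurable fun s t hst => measure_mono fun x hx => ?_
      exact lt_of_le_of_lt (ENNReal.ofReal_le_ofReal hst) hx
    rw [← lintegral_add_left (mono f)]
    refine setLIntegral_mono' measurableSet_Ioo fun t ht => ?_
    have ht1 : ENNReal.ofReal t < 1 := by simpa using ht.2
    refine bm1 (measurableSet_lt measurable_const hf) (measurableSet_lt measurable_const hg) ?_ ?_ ?_
    · rw [← hF] at ht1; exact lt_iSup_iff.1 ht1
    · rw [← hG] at ht1; exact lt_iSup_iff.1 ht1
    · intro a ha b hb
      simp only [mem_ofPred_eq, lt_min_iff] at *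
      refine ⟨?_, ht1⟩
      by_contra hc
      have h1 := H a b
      have h2 : ENNReal.ofReal t * ENNReal.ofReal t < f a * g b := ENNReal.mul_lt_mul ha hb
      have h3 : h ((a+b)/2) ^ 2 ≤ ENNReal.ofReal t ^ 2 := by
        gcongr; exact not_lt.1 hc
      rw [sq (ENNReal.ofReal t)] at h3
      exact absurd (lt_of_lt_of_le h2 (h1.trans h3)) (lt_irrefl _)
  generalize (∫⁻ x, f x) = a at *
  generalize (∫⁻ x, g x) = b at *
  generalize (∫⁻ x, h x) = c at *
  by_cases hc : c = ∞
  · simp [hc]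
  have hab : a + b ≠ ∞ := ne_top_of_le_ne_top (ENNReal.mul_ne_top (by simp) hc) key
  lift c to ℝ≥0 using hc
  lift a to ℝ≥0 using (fun h => hab (by simp [h]))
  lift b to ℝ≥0 using (fun h => hab (by simp [h]))
  norm_cast at *
  have : (a:ℝ) + b ≤ 2 * c := by exact_mod_cast key
  have : (a:ℝ) * b ≤ c^2 := by nlinarith [sq_nonneg ((a:ℝ) - b), a.2, b.2, c.2]
  exact_mod_cast this

lemma pl1_bdd {f g h : ℝ → ℝ≥0∞} (hf : Measurable f) (hg : Measurable g) (hh : Measurable h)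
    (hF : ⨆ x, f x ≠ ∞) (hG : ⨆ x, g x ≠ ∞)
    (H : ∀ x y, f x * g y ≤ h ((x + y) / 2) ^ 2) :
    (∫⁻ x, f x) * ∫⁻ x, g x ≤ (∫⁻ x, h x) ^ 2 := by
  set F := ⨆ x, f x with hFd
  set G := ⨆ x, g x with hGd
  by_cases hF0 : F = 0
  · have : ∀ x, f x = 0 := fun x => le_antisymm (hF0 ▸ le_iSup f x) (zero_le)
    simp [this]
  by_cases hG0 : G = 0
  · have : ∀ x, g x = 0 := fun x => le_antisymm (hG0 ▸ le_iSup g x) (zero_le)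
    simp [this]
  set c : ℝ≥0∞ := (F * G) ^ (1/2 : ℝ) with hc
  have hc2 : c ^ 2 = F * G := by
    rw [hc, ← ENNReal.rpow_natCast, ← ENNReal.rpow_mul]; simp
  have hFG : F * G ≠ ∞ := ENNReal.mul_ne_top hF hG
  have hFG0 : F * G ≠ 0 := mul_ne_zero hF0 hG0
  have hc0 : c ≠ 0 := by rintro h; rw [h] at hc2; simp at hc2; tauto
  have hct : c ≠ ∞ := by rintro h; rw [h] at hc2; simp at hc2; exact hFG hc2.symm
  have := pl1_norm (f := fun x => F⁻¹ * f x) (g := fun x => G⁻¹ * g x) (h := fun x => c⁻¹ * h x)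
    (hf.const_mul _) (hg.const_mul _) (hh.const_mul _)
    (by rw [← ENNReal.mul_iSup, ← hFd, ENNReal.inv_mul_cancel hF0 hF])
    (by rw [← ENNReal.mul_iSup, ← hGd, ENNReal.inv_mul_cancel hG0 hG])
    (by
      intro x y
      rw [mul_pow, ← ENNReal.inv_pow, hc2, ENNReal.mul_inv (by tauto) (by tauto)]
      calc _ = F⁻¹ * G⁻¹ * (f x * g y) := by ring
        _ ≤ _ := by gcongr; exact H x y)
  rw [lintegral_const_mul _ hf, lintegral_const_mul _ hg, lintegral_const_mul _ hh, mul_pow,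
    ← ENNReal.inv_pow, hc2] at this
  calc (∫⁻ x, f x) * ∫⁻ x, g x = (F * G) * (F⁻¹ * (∫⁻ x, f x) * (G⁻¹ * ∫⁻ x, g x)) := by
        rw [show (F * G) * (F⁻¹ * (∫⁻ x, f x) * (G⁻¹ * ∫⁻ x, g x)) =
          (F * F⁻¹) * (G * G⁻¹) * ((∫⁻ x, f x) * ∫⁻ x, g x) by ring,
          ENNReal.mul_inv_cancel hF0 hF, ENNReal.mul_inv_cancel hG0 hG]; simp
    _ ≤ (F * G) * ((F * G)⁻¹ * (∫⁻ x, h x) ^ 2) := by gcongr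
    _ = _ := by rw [← mul_assoc, ENNReal.mul_inv_cancel hFG0 hFG, one_mul]

lemma pl1 {f g h : ℝ → ℝ≥0∞} (hf : Measurable f) (hg : Measurable g) (hh : Measurable h)
    (H : ∀ x y, f x * g y ≤ h ((x + y) / 2) ^ 2) :
    (∫⁻ x, f x) * ∫⁻ x, g x ≤ (∫⁻ x, h x) ^ 2 := by
  have sup : ∀ f : ℝ → ℝ≥0∞, Measurable f → ∫⁻ x, f x = ⨆ n : ℕ, ∫⁻ x, min (f x) n := by
    intro f hf
    rw [← lintegral_iSup (fun n => hf.min measurable_const)]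
    · congr 1; ext x
      refine le_antisymm ?_ (iSup_le fun n => min_le_left _ _)
      refine ENNReal.le_of_forall_nnreal_lt fun r hr => ?_
      obtain ⟨n, hn⟩ := exists_nat_gt r
      refine le_iSup_of_le n (le_min hr.le ?_)
      exact_mod_cast hn.le
    · intro m n hmn x
      exact min_le_min le_rfl (by exact_mod_cast hmn)
  rw [sup f hf, sup g hg]
  simp only [ENNReal.iSup_mul, ENNReal.mul_iSup]
  refine iSup_le fun n => iSup_le fun m => ?_
  refine pl1_bdd (hf.min measurable_const) (hg.min measurable_const) hh ?_ ?_ ?_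
  · exact ne_top_of_le_ne_top (ENNReal.natCast_ne_top _) (iSup_le fun x => min_le_right _ _)
  · exact ne_top_of_le_ne_top (ENNReal.natCast_ne_top _) (iSup_le fun x => min_le_right _ _)
  · intro x y
    exact le_trans (mul_le_mul' (min_le_left _ _) (min_le_left _ _)) (H x y)

lemma lint_cons {n : ℕ} {f : (Fin (n+1) → ℝ) → ℝ≥0∞} (hf : Measurable f) :
    ∫⁻ x, f x = ∫⁻ t : ℝ, ∫⁻ x : Fin n → ℝ, f (Fin.cons t x) := by
  have := (volume_preserving_piFinSuccAbove (fun _ : Fin (n+1) => ℝ) 0).symm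
  rw [← this.lintegral_comp hf]
  rw [Measure.volume_eq_prod, lintegral_prod (fun a => f ((MeasurableEquiv.piFinSuccAbove (fun x => ℝ) 0).symm a)) (hf.comp this.measurable).aemeasurable]
  simp [MeasurableEquiv.piFinSuccAbove, Fin.insertNthEquiv]

lemma pln (n : ℕ) : ∀ {f g h : (Fin n → ℝ) → ℝ≥0∞} (_ : Measurable f) (_ : Measurable g)
    (_ : Measurable h) (_ : ∀ x y, f x * g y ≤ h ((1/2 : ℝ) • (x + y)) ^ 2),
    (∫⁻ x, f x) * ∫⁻ x, g x ≤ (∫⁻ x, h x) ^ 2 := by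
  induction n with
  | zero =>
    intro f g h hf hg hh H
    have : ∀ f : (Fin 0 → ℝ) → ℝ≥0∞, ∫⁻ x, f x = f default := by
      intro f
      rw [volume_pi, Measure.pi_of_empty _ default, lintegral_dirac]
    rw [this, this, this]
    convert H default default
  | succ n ih =>
    intro f g h hf hg hh H
    have mc : Measurable fun p : ℝ × (Fin n → ℝ) => (Fin.cons p.1 p.2 : Fin (n+1) → ℝ) := by
      refine measurable_pi_lambda _ fun i => ?_
      refine Fin.cases ?_ (fun j => ?_) i
      · simpa using measurable_fst
      · simp only [Fin.cons_succ]; fun_prop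
    rw [lint_cons hf, lint_cons hg, lint_cons hh]
    refine pl1 (hf.comp mc).lintegral_prod_right' (hg.comp mc).lintegral_prod_right'
      (hh.comp mc).lintegral_prod_right' fun s t => ?_
    have mk : ∀ s : ℝ, Measurable fun x : Fin n → ℝ => (Fin.cons s x : Fin (n+1) → ℝ) := fun s =>
      mc.comp measurable_prodMk_left
    refine ih (hf.comp (mk s)) (hg.comp (mk t)) (hh.comp (mk _)) fun x y => ?_
    convert H (Fin.cons s x) (Fin.cons t y) using 3
    ext i
    refine Fin.cases ?_ (fun j => ?_) i
    · simp; ring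
    · simp; ring

lemma omegaB_pos (k : ℕ) : 0 < omegaB k :=
  ENNReal.toReal_pos (measure_ball_pos _ _ one_pos).ne' measure_ball_lt_top.ne

noncomputable def cst (k : ℕ) : ℝ≥0∞ := ENNReal.ofReal (omegaB k / 2 ^ k)

lemma cst_ne_zero (k : ℕ) : cst k ≠ 0 := by
  have := omegaB_pos k
  simp only [cst, ne_eq, ENNReal.ofReal_eq_zero, not_le]; positivity

lemma cst_ne_top (k : ℕ) : cst k ≠ ∞ := ENNReal.ofReal_ne_top

lemma vol_cball (k : ℕ) (x : Euc k) {r : ℝ} (hr : 0 ≤ r) :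
    volume (closedBall x r) = cst k * ENNReal.ofReal (2 * r) ^ (k : ℝ) := by
  rw [Measure.addHaar_closedBall _ _ hr, cst]
  have h1 : volume (ball (0 : Euc k) 1) = ENNReal.ofReal (omegaB k) := by
    rw [omegaB, ENNReal.ofReal_toReal measure_ball_lt_top.ne]
  rw [h1, ENNReal.ofReal_rpow_of_nonneg (by positivity) (by positivity), ← ENNReal.ofReal_mul (by positivity),
    ← ENNReal.ofReal_mul (by have := omegaB_pos k; positivity)]
  congr 1
  rw [Real.rpow_natCast]
  simp
  field_simp
  ring

lemma isodiam (k : ℕ) (hk : 1 ≤ k) (A : Set (Euc k)) :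
    volume A ≤ cst k * ediam A ^ (k : ℝ) := by
  by_cases hA : ediam A = ∞
  · rw [hA, ENNReal.top_rpow_of_pos (by exact_mod_cast hk), ENNReal.mul_top (cst_ne_zero k)]
    exact le_top
  rw [← ediam_closure A] at *
  refine le_trans (measure_mono subset_closure) ?_
  have hB : IsClosed (closure A) := isClosed_closure
  generalize closure A = B at *
  set D := (ediam B).toReal with hD
  have hDe : ediam B = ENNReal.ofReal (2 * (D / 2)) := by
    rw [mul_div_cancel₀ _ (by norm_num), hD, ENNReal.ofReal_toReal hA]
  rw [hDe, ← vol_cball k 0 (by positivity)]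
  have mp := PiLp.volume_preserving_toLp (Fin k)
  have me : MeasurableEmbedding (WithLp.toLp 2 : (Fin k → ℝ) → Euc k) :=
    (MeasurableEquiv.toLp 2 (Fin k → ℝ)).measurableEmbedding
  have key := pln k (f := (WithLp.toLp 2 ⁻¹' B).indicator 1)
    (g := (WithLp.toLp 2 ⁻¹' (-B)).indicator 1)
    (h := (WithLp.toLp 2 ⁻¹' (closedBall (0 : Euc k) (D/2))).indicator 1)
    (measurable_one.indicator (mp.measurable hB.measurableSet))
    (measurable_one.indicator (mp.measurable hB.neg.measurableSet))
    (measurable_one.indicator (mp.measurable isClosed_closedBall.measurableSet))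
    (by
      intro x y
      by_cases hx : x ∈ WithLp.toLp 2 ⁻¹' B
      · by_cases hy : y ∈ WithLp.toLp 2 ⁻¹' (-B)
        · have : (1/2 : ℝ) • (x + y) ∈ WithLp.toLp 2 ⁻¹' (closedBall (0 : Euc k) (D/2)) := by
            simp only [mem_preimage, mem_closedBall, dist_zero_right, Set.mem_neg] at *
            have h1 : dist (WithLp.toLp 2 x : Euc k) (-(WithLp.toLp 2 y)) ≤ D := by
              have := edist_le_ediam_of_mem hx hy
              rw [hD, dist_edist]
              exact ENNReal.toReal_mono hA this
            rw [dist_eq_norm, sub_neg_eq_add] at h1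
            rw [WithLp.toLp_smul, WithLp.toLp_add, norm_smul]
            norm_num
            linarith
          rw [indicator_of_mem hx, indicator_of_mem hy, indicator_of_mem this]; simp
        · simp [indicator_of_notMem hy]
      · simp [indicator_of_notMem hx])
  rw [lintegral_indicator_one (mp.measurable hB.measurableSet),
    lintegral_indicator_one (mp.measurable hB.neg.measurableSet),
    lintegral_indicator_one (mp.measurable isClosed_closedBall.measurableSet),
    mp.measure_preimage_emb me, mp.measure_preimage_emb me, mp.measure_preimage_emb me,
    Measure.measure_neg, ← sq] at key
  exact (ENNReal.pow_le_pow_left_iff (by norm_num)).1 key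

lemma haus_le (k : ℕ) (hk : 1 ≤ k) (s : Set (Euc k)) :
    cst k * (μH[(k:ℝ)] : Measure (Euc k)) s ≤ volume s := by
  have h1 : ∀ n : ℕ, ∃ (t : Set (Euc k)) (r : Euc k → ℝ), t.Countable ∧ t ⊆ s ∧
      (∀ x ∈ t, r x ∈ Ioo (0:ℝ) (1/(n+1))) ∧
      (s ⊆ ⋃ x ∈ t, closedBall x (r x)) ∧ (∑' x : t, volume (closedBall (x : Euc k) (r x))) ≤ volume s + (n+1 : ℝ≥0∞)⁻¹ := by
    intro n
    refine Besicovitch.exists_closedBall_covering_tsum_measure_le volume (by simp) (fun _ => Ioo (0:ℝ) (1/(n+1))) s ?_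
    intro x _ δ hδ
    refine ⟨min δ (1/(n+1)) / 2, ?_⟩
    have : (0:ℝ) < 1/(n+1) := by positivity
    have : 0 < min δ (1/((n:ℝ)+1)) := lt_min hδ this
    have := min_le_left δ (1/((n:ℝ)+1))
    have := min_le_right δ (1/((n:ℝ)+1))
    refine ⟨⟨?_, ?_⟩, ?_, ?_⟩ <;> linarith
  choose t r htc hts hr hcov hsum using h1
  have hd : ∀ n, ∀ x : t n, ediam (closedBall (x : Euc k) (r n x)) ≤ ENNReal.ofReal (2 * r n x) := by
    intro n x
    refine ediam_le_of_forall_dist_le fun y hy z hz => ?_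
    rw [mem_closedBall] at hy hz
    linarith [dist_triangle_right y z (x : Euc k)]
  have : ∀ n, Countable (t n) := fun n => (htc n).to_subtype
  have key := Measure.hausdorffMeasure_le_liminf_tsum (ι := fun n => t n) (k:ℝ) s (l := atTop)
    (fun n : ℕ => ENNReal.ofReal (2 * (1/((n:ℝ)+1)))) (by
      rw [← ENNReal.ofReal_zero]
      refine ENNReal.tendsto_ofReal ?_
      simpa using tendsto_one_div_add_atTop_nhds_zero_nat.const_mul (2:ℝ))
    (fun n x => closedBall (x : Euc k) (r n x))
    (Eventually.of_forall fun n x => (hd n x).trans (ENNReal.ofReal_le_ofReal (by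
      have := (hr n x x.2).2; linarith)))
    (Eventually.of_forall fun n => by rw [← biUnion_eq_iUnion (t n) (fun x _ => closedBall x (r n x))]; exact hcov n)
  have h2 : ∀ n, ∑' x : t n, ediam (closedBall (x : Euc k) (r n x)) ^ (k:ℝ) ≤
      (cst k)⁻¹ * (volume s + (n+1 : ℝ≥0∞)⁻¹) := by
    intro n
    refine le_trans ?_ (mul_le_mul_right (hsum n) _)
    rw [← ENNReal.tsum_mul_left]
    refine ENNReal.tsum_le_tsum fun x => ?_
    rw [vol_cball k _ (hr n x x.2).1.le, ← mul_assoc, ENNReal.inv_mul_cancel (cst_ne_zero k) (cst_ne_top k), one_mul]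
    gcongr
    exact hd n x
  have h3 : Tendsto (fun n : ℕ => (cst k)⁻¹ * (volume s + (n+1 : ℝ≥0∞)⁻¹)) atTop (nhds ((cst k)⁻¹ * (volume s + 0))) := by
    refine ENNReal.Tendsto.const_mul (tendsto_const_nhds.add ?_) (Or.inr (by simp [cst_ne_zero]))
    have := ENNReal.tendsto_inv_nat_nhds_zero.comp (tendsto_add_atTop_nat 1)
    simpa [Function.comp_def] using this
  have h4 := key.trans ((liminf_le_liminf (Eventually.of_forall h2)).trans_eq h3.liminf_eq)
  rw [add_zero] at h4
  calc _ ≤ cst k * ((cst k)⁻¹ * volume s) := by gcongr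
    _ = _ := by rw [← mul_assoc, ENNReal.mul_inv_cancel (cst_ne_zero k) (cst_ne_top k), one_mul]

lemma haus_eq (k : ℕ) (hk : 1 ≤ k) (s : Set (Euc k)) :
    cst k * (μH[(k:ℝ)] : Measure (Euc k)) s = volume s := by
  refine le_antisymm (haus_le k hk s) ?_
  have := Measure.le_hausdorffMeasure (X := Euc k) k ((cst k)⁻¹ • volume) 1 one_pos (fun s _ => by
    rw [Measure.smul_apply, smul_eq_mul]
    refine (mul_le_mul_right (isodiam k hk s) _).trans_eq ?_
    rw [← mul_assoc, ENNReal.inv_mul_cancel (cst_ne_zero k) (cst_ne_top k), one_mul])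
  have := this s
  rw [Measure.smul_apply, smul_eq_mul] at this
  calc volume s = cst k * ((cst k)⁻¹ * volume s) := by
        rw [← mul_assoc, ENNReal.mul_inv_cancel (cst_ne_zero k) (cst_ne_top k), one_mul]
    _ ≤ _ := by gcongr

abbrev QQ (k : ℕ) : Type := WithLp 2 (Euc k × ℝ)

lemma real_int (k : ℕ) {ρ : ℝ} (hρ : 0 < ρ) :
    ∫ t in (0:ℝ)..ρ, t * (ρ^2 - t^2) ^ ((k:ℝ)/2) = ρ^(k+2) / (k+2) := by
  have : ∀ t ∈ uIcc 0 ρ, HasDerivAt (fun t : ℝ => -((ρ^2 - t^2) ^ ((k:ℝ)/2+1) / (k+2)))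
      (t * (ρ^2 - t^2) ^ ((k:ℝ)/2)) t := by
    intro t _
    have h1 : HasDerivAt (fun t : ℝ => ρ^2 - t^2) (-(2*t)) t := by
      simpa using ((hasDerivAt_pow 2 t).const_sub (ρ^2))
    have h2 := ((h1.rpow_const (p := (k:ℝ)/2+1) (Or.inr (by linarith [show (0:ℝ) ≤ (k:ℝ)/2 by positivity]))).div_const ((k:ℝ)+2)).neg
    refine h2.congr_deriv ?_
    simp only [add_sub_cancel_right]
    field_simp
    try ring
  rw [intervalIntegral.integral_eq_sub_of_hasDerivAt this]
  · have h0 : (k:ℝ)/2+1 ≠ 0 := by positivity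
    simp only [sub_self, Real.zero_rpow h0]
    have : (ρ^2 - 0^2) ^ ((k:ℝ)/2+1) = ρ^(k+2) := by
      rw [show ρ^2 - 0^2 = ρ^(2:ℝ) by norm_num, ← Real.rpow_mul hρ.le, ← Real.rpow_natCast]
      congr 1; push_cast; ring
    rw [this]; ring
  · apply Continuous.intervalIntegrable
    refine continuous_id.mul (Continuous.rpow_const (by fun_prop) fun x => Or.inr (by positivity))

lemma half_moment (k : ℕ) {ρ : ℝ} (hρ : 0 < ρ) :
    ∫⁻ h : QQ k, (ball (0 : QQ k) ρ).indicator (fun h => ENNReal.ofReal h.snd) h =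
      ENNReal.ofReal (omegaB k / (k+2)) * ENNReal.ofReal (ρ ^ (k+2)) := by
  have mp := WithLp.volume_preserving_toLp (U := Euc k) (V := ℝ)
  have hmeas : Measurable ((ball (0 : QQ k) ρ).indicator (fun h => ENNReal.ofReal h.snd)) := by
    refine Measurable.indicator ?_ isOpen_ball.measurableSet
    exact ENNReal.measurable_ofReal.comp ((WithLp.prod_continuous_ofLp 2 (Euc k) ℝ).snd.measurable)
  rw [← mp.lintegral_comp hmeas, Measure.volume_eq_prod,
    lintegral_prod_symm' (fun a => (ball (0 : QQ k) ρ).indicator (fun h => ENNReal.ofReal h.snd) (WithLp.toLp 2 a)) (hmeas.comp mp.measurable)]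
  have e : ∀ t : ℝ, ∫⁻ x : Euc k, (ball (0 : QQ k) ρ).indicator (fun h => ENNReal.ofReal h.snd) (WithLp.toLp 2 (x, t))
      = (Ioo 0 ρ).indicator (fun t => ENNReal.ofReal (t * (ρ^2 - t^2) ^ ((k:ℝ)/2)) * ENNReal.ofReal (omegaB k)) t := by
    intro t
    have hmem : ∀ x : Euc k, (WithLp.toLp 2 (x, t) : QQ k) ∈ ball (0 : QQ k) ρ ↔ ‖x‖^2 + t^2 < ρ^2 := by
      intro x
      rw [mem_ball_zero_iff, ← sq_lt_sq₀ (norm_nonneg _) hρ.le, WithLp.prod_norm_sq_eq_of_L2]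
      simp
    by_cases ht : t ∈ Ioo 0 ρ
    · rw [indicator_of_mem ht]
      have hn : 0 < ρ^2 - t^2 := by nlinarith [ht.1, ht.2]
      have e2 : ∀ x : Euc k, (ball (0 : QQ k) ρ).indicator (fun h => ENNReal.ofReal h.snd) (WithLp.toLp 2 (x, t)) =
          (ball (0 : Euc k) (√(ρ^2 - t^2))).indicator (fun _ => ENNReal.ofReal t) x := by
        intro x
        have : (WithLp.toLp 2 (x, t) : QQ k) ∈ ball (0 : QQ k) ρ ↔ x ∈ ball (0 : Euc k) (√(ρ^2 - t^2)) := by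
          rw [hmem, mem_ball_zero_iff, Real.lt_sqrt (norm_nonneg _)]
          constructor <;> intro h <;> linarith
        by_cases hx : x ∈ ball (0 : Euc k) (√(ρ^2 - t^2))
        · rw [indicator_of_mem hx, indicator_of_mem (this.2 hx)]; rfl
        · rw [indicator_of_notMem hx, indicator_of_notMem (fun h => hx (this.1 h))]
      simp_rw [e2]
      rw [lintegral_indicator isOpen_ball.measurableSet, setLIntegral_const, ENNReal.ofReal_mul ht.1.le, mul_assoc]
      congr 1
      have h1 : volume (ball (0 : Euc k) 1) = ENNReal.ofReal (omegaB k) := by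
        rw [omegaB, ENNReal.ofReal_toReal measure_ball_lt_top.ne]
      rw [Measure.addHaar_ball_of_pos _ _ (Real.sqrt_pos.2 hn), h1, finrank_euclideanSpace_fin]
      congr 2
      rw [Real.sqrt_eq_rpow, ← Real.rpow_natCast, ← Real.rpow_mul hn.le]
      congr 1; ring
    · rw [indicator_of_notMem ht]
      refine (lintegral_congr fun x => ?_).trans lintegral_zero
      by_cases hx : (WithLp.toLp 2 (x, t) : QQ k) ∈ ball (0 : QQ k) ρ
      · rw [indicator_of_mem hx, ENNReal.ofReal_eq_zero]
        change t ≤ 0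
        rw [hmem] at hx
        by_contra hc
        exact ht ⟨not_le.1 hc, by nlinarith [sq_nonneg ‖x‖, not_le.1 hc]⟩
      · simp [indicator_of_notMem hx]
  simp_rw [e]
  rw [lintegral_indicator measurableSet_Ioo, lintegral_mul_const' _ _ (by simp), 
    ← ofReal_integral_eq_lintegral_ofReal, ← integral_Ioc_eq_integral_Ioo, ← intervalIntegral.integral_of_le hρ.le, real_int k hρ, 
    ← ENNReal.ofReal_mul (by positivity), ← ENNReal.ofReal_mul (by have := omegaB_pos k; positivity)]
  · congr 1; ring
  · have : Continuous fun t : ℝ => t * (ρ^2 - t^2) ^ ((k:ℝ)/2) :=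
      continuous_id.mul (Continuous.rpow_const (by fun_prop) fun x => Or.inr (by positivity))
    exact (this.integrableOn_Icc).mono_set Ioo_subset_Icc_self
  · refine (ae_restrict_iff' measurableSet_Ioo).2 (Eventually.of_forall fun t ht => ?_)
    have hn : 0 < ρ^2 - t^2 := by nlinarith [ht.1, ht.2]
    exact mul_nonneg ht.1.le (by positivity)

def HS (k : ℕ) (B : Set (Euc k)) (ρ : ℝ) : Set (QQ k × QQ k) :=
  {p | p.1.fst ∈ B ∧ p.1.snd < 0 ∧ 0 ≤ p.2.snd ∧ dist p.1 p.2 < ρ}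

lemma meas_fst (k : ℕ) : Measurable fun u : QQ k => u.fst :=
  (WithLp.prod_continuous_ofLp 2 (Euc k) ℝ).fst.measurable
lemma meas_snd (k : ℕ) : Measurable fun u : QQ k => u.snd :=
  (WithLp.prod_continuous_ofLp 2 (Euc k) ℝ).snd.measurable

lemma HS_meas (k : ℕ) {B : Set (Euc k)} (hB : MeasurableSet B) (ρ : ℝ) :
    MeasurableSet (HS k B ρ) := by
  refine ((meas_fst k).comp measurable_fst hB).inter
    ((measurableSet_lt ((meas_snd k).comp measurable_fst) measurable_const).inter
    ((measurableSet_le measurable_const ((meas_snd k).comp measurable_snd)).inter ?_))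
  exact measurableSet_lt (continuous_dist.measurable) measurable_const

lemma HS_vol (k : ℕ) {B : Set (Euc k)} (hB : MeasurableSet B) {ρ : ℝ} (hρ : 0 < ρ) :
    ((volume : Measure (QQ k)).prod volume) (HS k B ρ) =
      ENNReal.ofReal (omegaB k / (k+2)) * ENNReal.ofReal (ρ ^ (k+2)) * volume B := by
  have mp := measurePreserving_prod_add (volume : Measure (QQ k)) (volume : Measure (QQ k))
  rw [← mp.measure_preimage (HS_meas k hB ρ).nullMeasurableSet,
    Measure.prod_apply_symm (mp.measurable (HS_meas k hB ρ)), ← half_moment k hρ]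
  rw [← lintegral_mul_const]
  · congr 1; ext h
    by_cases hh : h ∈ ball (0 : QQ k) ρ
    · rw [indicator_of_mem hh]
      have mq := WithLp.volume_preserving_ofLp (U := Euc k) (V := ℝ)
      have : (fun x => (x, h)) ⁻¹' ((fun z : QQ k × QQ k => (z.1, z.1 + z.2)) ⁻¹' HS k B ρ) =
        WithLp.ofLp ⁻¹' (B ×ˢ Ico (-h.snd) 0) := by
        ext u
        simp only [HS, mem_preimage, mem_ofPred_eq, mem_prod, mem_Ico, WithLp.add_snd, dist_self_add_right]
        rw [mem_ball_zero_iff] at hh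
        simp only [hh, and_true]
        change _ ↔ u.fst ∈ B ∧ -h.snd ≤ u.snd ∧ u.snd < 0
        constructor
        · rintro ⟨a, b, c⟩; exact ⟨a, by linarith [c], b⟩
        · rintro ⟨a, b, c⟩; exact ⟨a, c, by linarith [b]⟩
      rw [this, mq.measure_preimage (hB.prod measurableSet_Ico).nullMeasurableSet, Measure.volume_eq_prod, Measure.prod_prod, Real.volume_Ico, mul_comm]
      simp
    · rw [indicator_of_notMem hh]
      have : (fun x => (x, h)) ⁻¹' ((fun z : QQ k × QQ k => (z.1, z.1 + z.2)) ⁻¹' HS k B ρ) = ∅ := by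
        ext u
        simp only [HS, mem_preimage, mem_ofPred_eq, dist_self_add_right]
        rw [mem_ball_zero_iff] at hh
        simp [hh]
      simp [this]
  · exact Measurable.indicator (ENNReal.measurable_ofReal.comp (meas_snd k)) isOpen_ball.measurableSet

structure IsChart (k : ℕ) (E : Set (Euc (k+1))) (lam : ℝ≥0)
    (F : OpenPartialHomeomorph (Euc (k+1)) (QQ k)) : Prop where
  lip : LipschitzOnWith lam F F.source
  alip : LipschitzOnWith lam F.symm F.target
  neg : ∀ x ∈ F.source, (F x).snd < 0 ↔ x ∈ E
  zero : ∀ x ∈ F.source, (F x).snd = 0 ↔ x ∈ frontier E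

lemma exists_isom (k : ℕ) (D : Euc (k+1) →L[ℝ] ℝ) (hD : D ≠ 0) :
    ∃ (c : ℝ) (_ : 0 < c) (T : Euc (k+1) →L[ℝ] Euc k), ∀ x, ‖x‖^2 = ‖T x‖^2 + (c * D x)^2 := by
  set v := (InnerProductSpace.toDual ℝ (Euc (k+1))).symm D with hv
  have hv0 : v ≠ 0 := by simpa [hv] using hD
  have hvD : ∀ x, inner ℝ v x = D x := fun x => by
    rw [hv, InnerProductSpace.toDual_symm_apply]
  have : Fact (Module.finrank ℝ (Euc (k+1)) = k + 1) := ⟨by simp⟩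
  let b := OrthonormalBasis.fromOrthogonalSpanSingleton (𝕜 := ℝ) k hv0
  refine ⟨‖v‖⁻¹, by positivity, b.repr.toContinuousLinearEquiv.toContinuousLinearMap ∘L (ℝ ∙ v)ᗮ.orthogonalProjectionOnto, fun x => ?_⟩
  have h1 := Submodule.norm_sq_eq_add_norm_sq_projection x (ℝ ∙ v)
  have h2 : ‖(ℝ ∙ v).orthogonalProjectionOnto x‖^2 = (‖v‖⁻¹ * D x)^2 := by
    have := Submodule.starProjection_singleton (𝕜 := ℝ) (v := v) x
    rw [show ‖(ℝ ∙ v).orthogonalProjectionOnto x‖ = ‖((ℝ ∙ v).orthogonalProjectionOnto x : Euc (k+1))‖ from rfl]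
    have e : ((ℝ ∙ v).orthogonalProjectionOnto x : Euc (k+1)) = (ℝ ∙ v).starProjection x := rfl
    rw [e, this, norm_smul, hvD]
    have : ‖v‖ ≠ 0 := by simpa using hv0
    simp only [RCLike.ofReal_real_eq_id, id, norm_div, norm_pow, Real.norm_eq_abs, abs_norm]
    rw [mul_pow, div_pow, sq_abs]
    field_simp
  rw [h1, h2, add_comm]
  congr 2
  simp

lemma exists_chart (k : ℕ) {E : Set (Euc (k+1))} {f : Euc (k+1) → ℝ} (hf : ContDiff ℝ 2 f)
    (hE : E = {x | f x < 0}) (hfr : frontier E = {x | f x = 0}) {p : Euc (k+1)}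
    (hdf : fderiv ℝ f p ≠ 0) {lam : ℝ≥0} (hl : 1 < lam) :
    ∃ F : OpenPartialHomeomorph (Euc (k+1)) (QQ k), p ∈ F.source ∧ IsChart k E lam F := by
  obtain ⟨c, hc, T, hT⟩ := exists_isom k (fderiv ℝ f p) hdf
  let L := (WithLp.prodContinuousLinearEquiv 2 ℝ (Euc k) ℝ).symm
  let Λ0 : Euc (k+1) →L[ℝ] QQ k := L.toContinuousLinearMap ∘L (T.prod (c • fderiv ℝ f p))
  have hΛ0 : ∀ x, ‖Λ0 x‖ = ‖x‖ := by
    intro x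
    rw [← sq_eq_sq₀ (norm_nonneg _) (norm_nonneg _), hT x, WithLp.prod_norm_sq_eq_of_L2]
    simp [Λ0, L, mul_pow]
  let Λ1 : Euc (k+1) →ₗᵢ[ℝ] QQ k := ⟨Λ0.toLinearMap, hΛ0⟩
  let Λ := (Λ1.toLinearIsometryEquiv (by
    rw [LinearEquiv.finrank_eq (WithLp.linearEquiv 2 ℝ (Euc k × ℝ))]; simp)).toContinuousLinearEquiv
  have hΛ : (Λ : Euc (k+1) →L[ℝ] QQ k) = Λ0 := by rfl
  let F0 : Euc (k+1) → QQ k := fun x => L (T x, c * f x)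
  have hF0 : HasStrictFDerivAt F0 (Λ : Euc (k+1) →L[ℝ] QQ k) p := by
    rw [hΛ]
    have h1 : HasStrictFDerivAt f (fderiv ℝ f p) p := (hf.contDiffAt.hasStrictFDerivAt (by norm_num))
    have h2 : HasStrictFDerivAt (fun x => (T x, c * f x)) (T.prod (c • fderiv ℝ f p)) p :=
      T.hasStrictFDerivAt.prodMk (h1.const_mul c)
    exact L.toContinuousLinearMap.hasStrictFDerivAt.comp p h2
  have hl0 : (0:ℝ) < lam := lt_trans one_pos (by exact_mod_cast hl)
  have hl1 : (1:ℝ) < lam := by exact_mod_cast hl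
  have hεp : 0 < 1 - 1/(lam:ℝ) := by
    rw [sub_pos, div_lt_one hl0]; exact_mod_cast hl
  obtain ⟨s, hs, hap⟩ := hF0.approximates_deriv_on_nhds (c := ⟨1 - 1/(lam:ℝ), hεp.le⟩) (Or.inr hεp)
  refine ⟨(hF0.toOpenPartialHomeomorph F0).restr s, ?_, ?_⟩
  · rw [OpenPartialHomeomorph.restr_source]
    exact ⟨hF0.mem_toOpenPartialHomeomorph_source, mem_interior_iff_mem_nhds.2 hs⟩
  · set F := (hF0.toOpenPartialHomeomorph F0).restr s with hF
    have hFc : ∀ x, F x = F0 x := fun x => rfl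
    have hsrc : ∀ x ∈ F.source, x ∈ s := by
      intro x hx
      rw [hF, OpenPartialHomeomorph.restr_source] at hx
      exact interior_subset hx.2
    have hsnd : ∀ x, (F x).snd = c * f x := fun x => rfl
    have hb : ∀ x ∈ F.source, ∀ y ∈ F.source,
        dist (F x) (F y) ≤ lam * dist x y ∧ dist x y ≤ lam * dist (F x) (F y) := by
      intro x hx y hy
      have h1 := hap x (hsrc x hx) y (hsrc y hy)
      rw [hΛ] at h1
      have h1 : ‖F0 x - F0 y - Λ0 (x - y)‖ ≤ (1 - 1/(lam:ℝ)) * ‖x - y‖ := h1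
      have h2 := hΛ0 (x - y)
      rw [hFc, hFc, dist_eq_norm, dist_eq_norm]
      have h3 := norm_sub_norm_le (F0 x - F0 y) (Λ0 (x - y))
      have h4 := norm_sub_norm_le (Λ0 (x - y)) (F0 x - F0 y)
      rw [norm_sub_rev (Λ0 (x-y))] at h4
      have h5 : 2 - 1/(lam:ℝ) ≤ lam := by
        rw [sub_le_iff_le_add, ← sub_le_iff_le_add', le_div_iff₀ hl0]
        linarith [sq_nonneg ((lam:ℝ) - 1), show ((lam:ℝ) - 1)^2 = lam * lam - 2 * lam + 1 by ring]
      have h6 := norm_nonneg (x - y)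
      constructor
      · have h7 := mul_le_mul_of_nonneg_right h5 h6
        linarith
      · have : 1/(lam:ℝ) * ‖x - y‖ ≤ ‖F0 x - F0 y‖ := by linarith
        rw [one_div, inv_mul_le_iff₀ hl0] at this
        exact this
    refine ⟨?_, ?_, ?_, ?_⟩
    · exact LipschitzOnWith.of_dist_le_mul fun x hx y hy => (hb x hx y hy).1
    · refine LipschitzOnWith.of_dist_le_mul fun x hx y hy => ?_
      have := (hb _ (F.map_target hx) _ (F.map_target hy)).2
      rwa [F.right_inv hx, F.right_inv hy] at this
    · intro x _
      rw [hsnd, hE]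
      simp [mul_neg_iff, hc, not_lt.2 hc.le]
    · intro x _
      rw [hsnd, hfr]
      simp [hc.ne']

lemma prod_chart {X Y : Type*} [TopologicalSpace X] [TopologicalSpace Y] [MeasurableSpace X]
    [MeasurableSpace Y] [BorelSpace X] [BorelSpace Y] (μ : Measure X) (ν : Measure Y)
    [SFinite μ] [SFinite ν] (F : OpenPartialHomeomorph X Y) (y₀ : Y) (c : ℝ≥0)
    (h : ∀ S, μ (F.source ∩ F ⁻¹' S) ≤ c * ν S) (T : Set (Y × Y)) :
    (μ.prod μ) {p | p.1 ∈ F.source ∧ p.2 ∈ F.source ∧ (F p.1, F p.2) ∈ T}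
      ≤ c * c * (ν.prod ν) T := by
  classical
  rw [← measure_toMeasurable T]
  refine (measure_mono (t := {p | p.1 ∈ F.source ∧ p.2 ∈ F.source ∧
    (F p.1, F p.2) ∈ toMeasurable (ν.prod ν) T}) ?_).trans ?_
  · rintro p ⟨h1, h2, h3⟩
    exact ⟨h1, h2, subset_toMeasurable _ _ h3⟩
  generalize hT' : toMeasurable (ν.prod ν) T = T'
  have hT : MeasurableSet T' := hT' ▸ measurableSet_toMeasurable _ _
  set G : X → Y := F.source.piecewise F (fun _ => y₀) with hG
  have hGm : Measurable G :=
    ContinuousOn.measurable_piecewise F.continuousOn continuousOn_const F.open_source.measurableSet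
  have hGF : ∀ x ∈ F.source, G x = F x := fun x hx => Set.piecewise_eq_of_mem _ _ _ hx
  have hm : (μ.restrict F.source).map G ≤ c • ν := by
    refine Measure.le_iff.2 fun S hS => ?_
    rw [Measure.map_apply hGm hS, Measure.restrict_apply (hGm hS)]
    refine le_trans (measure_mono ?_) (h S)
    rintro x ⟨hx, hx2⟩
    exact ⟨hx2, by simpa [hGF x hx2] using hx⟩
  have h2 := Measure.prod_mono hm hm
  have h3 := h2 T'
  rw [Measure.map_prod_map _ _ hGm hGm, Measure.map_apply (hGm.prodMap hGm) hT,
    Measure.prod_restrict, Measure.restrict_apply ((hGm.prodMap hGm) hT)] at h3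
  refine (measure_mono ?_).trans (h3.trans (le_of_eq ?_))
  · rintro p ⟨h1, h2, h3⟩
    refine ⟨?_, h1, h2⟩
    simpa [Prod.map, hGF _ h1, hGF _ h2] using h3
  · rw [Measure.prod_smul_left, Measure.prod_smul_right]
    simp only [Measure.smul_apply, ENNReal.smul_def, smul_eq_mul, mul_assoc]

lemma haus_eq_QQ (k : ℕ) (s : Set (QQ k)) :
    cst (k+1) * (μH[((k+1 : ℕ):ℝ)] : Measure (QQ k)) s = volume s := by
  have hfr : Module.finrank ℝ (QQ k) = k + 1 := by
    simp [QQ, (WithLp.linearEquiv 2 ℝ (Euc k × ℝ)).finrank_eq]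
  let e : QQ k ≃ₗᵢ[ℝ] Euc (k+1) :=
    ((stdOrthonormalBasis ℝ (QQ k)).reindex (finCongr hfr)).repr
  have h1 := haus_eq (k+1) (by omega) (e '' s)
  have h2 : (μH[((k+1 : ℕ):ℝ)] : Measure (Euc (k+1))) (e '' s) = (μH[((k+1 : ℕ):ℝ)] : Measure (QQ k)) s :=
    e.toIsometryEquiv.hausdorffMeasure_image _ _
  rw [← h2, h1]
  have h3 := (e.symm.measurePreserving).measure_preimage_emb
    (e.symm.toHomeomorph.measurableEmbedding) s
  rw [← h3]
  congr 1
  ext x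
  constructor
  · rintro ⟨y, hy, rfl⟩
    simpa using hy
  · intro hx
    exact ⟨e.symm x, hx, by simp⟩

lemma chart_A {k : ℕ} {E : Set (Euc (k+1))} {lam : ℝ≥0}
    {F : OpenPartialHomeomorph (Euc (k+1)) (QQ k)} (hF : IsChart k E lam F) (S : Set (QQ k)) :
    volume (F.source ∩ F ⁻¹' S) ≤ (lam^(k+1) : ℝ≥0) * volume S := by
  have h := (hF.alip.mono (s := F.target ∩ S) inter_subset_left).hausdorffMeasure_image_le
    (d := ((k+1 : ℕ):ℝ)) (by positivity)
  rw [← haus_eq_QQ, ← haus_eq (k+1) (by omega)]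
  calc _ ≤ cst (k+1) * (μH[((k+1 : ℕ):ℝ)]) (F.symm '' (F.target ∩ S)) := by
        gcongr
        rintro x ⟨hx, hx2⟩
        exact ⟨F x, ⟨F.map_source hx, hx2⟩, F.left_inv hx⟩
    _ ≤ cst (k+1) * ((lam : ℝ≥0∞) ^ ((k+1 : ℕ):ℝ) * μH[((k+1 : ℕ):ℝ)] S) := by
        gcongr
        exact h.trans (by gcongr; exact inter_subset_right)
    _ = _ := by
        rw [ENNReal.rpow_natCast]; push_cast; ring

lemma chart_B {k : ℕ} {E : Set (Euc (k+1))} {lam : ℝ≥0}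
    {F : OpenPartialHomeomorph (Euc (k+1)) (QQ k)} (hF : IsChart k E lam F) (S : Set (Euc (k+1))) :
    volume (F.target ∩ F.symm ⁻¹' S) ≤ (lam^(k+1) : ℝ≥0) * volume S := by
  have h := (hF.lip.mono (s := F.source ∩ S) inter_subset_left).hausdorffMeasure_image_le
    (d := ((k+1 : ℕ):ℝ)) (by positivity)
  rw [← haus_eq_QQ, ← haus_eq (k+1) (by omega)]
  calc _ ≤ cst (k+1) * (μH[((k+1 : ℕ):ℝ)]) (F '' (F.source ∩ S)) := by
        gcongr
        rintro x ⟨hx, hx2⟩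
        exact ⟨F.symm x, ⟨F.map_target hx, hx2⟩, F.right_inv hx⟩
    _ ≤ cst (k+1) * ((lam : ℝ≥0∞) ^ ((k+1 : ℕ):ℝ) * μH[((k+1 : ℕ):ℝ)] S) := by
        gcongr
        exact h.trans (by gcongr; exact inter_subset_right)
    _ = _ := by
        rw [ENNReal.rpow_natCast]; push_cast; ring

/-- embedding of the hyperplane -/
def iot (k : ℕ) (u : Euc k) : QQ k := WithLp.toLp 2 (u, 0)

lemma iot_isom (k : ℕ) : Isometry (iot k) := by
  refine Isometry.of_dist_eq fun u v => ?_
  have : ‖iot k u - iot k v‖ ^ 2 = ‖u - v‖ ^ 2 := by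
    rw [WithLp.prod_norm_sq_eq_of_L2]
    simp [iot]
  rw [dist_eq_norm, dist_eq_norm]
  exact (sq_eq_sq₀ (norm_nonneg _) (norm_nonneg _)).1 this

lemma Hstd_app (d k : ℕ) (S : Set (Euc d)) : Hstd d k S = cst k * μH[(k:ℝ)] S := rfl

lemma chart_C1 {k : ℕ} (hk : 1 ≤ k) {E : Set (Euc (k+1))} {lam : ℝ≥0}
    {F : OpenPartialHomeomorph (Euc (k+1)) (QQ k)} (hF : IsChart k E lam F) {B : Set (Euc k)}
    (hB : iot k '' B ⊆ F.target) :
    Hstd (k+1) k (F.symm '' (iot k '' B)) ≤ (lam^k : ℝ≥0) * volume B := by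
  have h := (hF.alip.mono hB).hausdorffMeasure_image_le (d := (k:ℝ)) (by positivity)
  rw [(iot_isom k).hausdorffMeasure_image (Or.inl (by positivity))] at h
  rw [← haus_eq k hk]
  rw [Hstd_app]
  calc _ ≤ cst k * ((lam : ℝ≥0∞) ^ (k:ℝ) * μH[(k:ℝ)] B) := by gcongr
    _ = _ := by rw [ENNReal.rpow_natCast]; push_cast; ring

lemma chart_C2 {k : ℕ} (hk : 1 ≤ k) {E : Set (Euc (k+1))} {lam : ℝ≥0}
    {F : OpenPartialHomeomorph (Euc (k+1)) (QQ k)} (hF : IsChart k E lam F) {B : Set (Euc k)}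
    (hB : iot k '' B ⊆ F.target) :
    volume B ≤ (lam^k : ℝ≥0) * Hstd (k+1) k (F.symm '' (iot k '' B)) := by
  have hs : F.symm '' (iot k '' B) ⊆ F.source := by
    rintro _ ⟨u, hu, rfl⟩
    exact F.map_target (hB hu)
  have h := (hF.lip.mono hs).hausdorffMeasure_image_le (d := (k:ℝ)) (by positivity)
  have h2 : F '' (F.symm '' (iot k '' B)) = iot k '' B := by
    rw [← image_comp]
    refine (image_congr fun u hu => ?_).trans (image_id _)
    exact F.right_inv (hB hu)
  rw [h2, (iot_isom k).hausdorffMeasure_image (Or.inl (by positivity))] at h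
  rw [← haus_eq k hk]
  rw [Hstd_app]
  calc _ ≤ cst k * ((lam : ℝ≥0∞) ^ (k:ℝ) * μH[(k:ℝ)] _) := mul_le_mul_right h _
    _ = _ := by rw [ENNReal.rpow_natCast]; push_cast; ring

/-- pairs across the boundary at distance less than `ρ` -/
def PS {k : ℕ} (E : Set (Euc k)) (ρ : ℝ) : Set (Euc k × Euc k) :=
  {p | p.1 ∈ E ∧ p.2 ∉ E ∧ dist p.1 p.2 < ρ}

lemma chart_up {k : ℕ} {E : Set (Euc (k+1))} {lam : ℝ≥0} (hl : 0 < lam)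
    {F : OpenPartialHomeomorph (Euc (k+1)) (QQ k)} (hF : IsChart k E lam F)
    {V : Set (Euc (k+1))} {O : Set (Euc k)} {ρ : ℝ} 
    (hV : ∀ x ∈ V, ball x ρ ⊆ F.source ∧ (F x).fst ∈ O) (hρ : 0 < ρ) :
    (volume.prod volume) {p | p ∈ PS E ρ ∧ p.1 ∈ V} ≤
      (lam^(k+1) : ℝ≥0) * (lam^(k+1) : ℝ≥0) * (volume.prod volume) (HS k O (lam * ρ)) := by
  refine le_trans (measure_mono ?_) (prod_chart volume volume F 0 _ (chart_A hF) _)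
  rintro ⟨x, y⟩ ⟨⟨hx, hy, hxy⟩, hxV⟩
  simp only at hx hy hxy hxV
  obtain ⟨hb, hO⟩ := hV x hxV
  have hxs := hb (mem_ball_self hρ)
  have hys := hb (show y ∈ ball x ρ by rwa [mem_ball, dist_comm])
  refine ⟨hxs, hys, hO, (hF.neg x hxs).2 hx, ?_, ?_⟩
  · exact not_lt.1 fun h => hy ((hF.neg y hys).1 h)
  · refine lt_of_le_of_lt (hF.lip.dist_le_mul x hxs y hys) ?_
    exact mul_lt_mul_of_pos_left hxy (by exact_mod_cast hl)

lemma chart_low {k : ℕ} {E : Set (Euc (k+1))} {lam : ℝ≥0} (hl : 1 ≤ lam)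
    {F : OpenPartialHomeomorph (Euc (k+1)) (QQ k)} (hF : IsChart k E lam F)
    {N : Set (Euc (k+1))} {K : Set (Euc k)} {ρ : ℝ} 
    (hV : ∀ u ∈ K, ball (iot k u) (2 * ρ) ⊆ F.target ∩ F.symm ⁻¹' N) (hρ : 0 < ρ) :
    (volume.prod volume) (HS k K (ρ / lam)) ≤
      (lam^(k+1) : ℝ≥0) * (lam^(k+1) : ℝ≥0) * (volume.prod volume) {p | p ∈ PS E ρ ∧ p.1 ∈ N} := by
  refine le_trans (measure_mono ?_) (prod_chart volume volume F.symm 0 _ (chart_B hF) _)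
  rintro ⟨u, v⟩ ⟨hK, hu, hv, huv⟩
  simp only at hK hu hv huv
  have hl0 : (1:ℝ) ≤ lam := by exact_mod_cast hl
  have hle : ρ / lam ≤ ρ := div_le_self hρ.le hl0
  have hd1 : dist u (iot k u.fst) = -u.snd := by
    have : ‖u - iot k u.fst‖ ^ 2 = (-u.snd) ^ 2 := by
      rw [WithLp.prod_norm_sq_eq_of_L2]
      simp [iot]
    rw [dist_eq_norm]
    exact (sq_eq_sq₀ (norm_nonneg _) (by linarith)).1 this
  have hd2 : -u.snd ≤ dist u v := by
    have : (v.snd - u.snd) ^ 2 ≤ ‖u - v‖ ^ 2 := by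
      rw [WithLp.prod_norm_sq_eq_of_L2]
      have : ‖(u - v).snd‖ ^ 2 = (v.snd - u.snd) ^ 2 := by
        simp; ring
      have := sq_nonneg ‖(u - v).fst‖
      linarith
    rw [dist_eq_norm]
    have := (sq_le_sq₀ (by linarith) (norm_nonneg _)).1 this
    linarith
  have hu1 : u ∈ ball (iot k u.fst) (2 * ρ) := by
    rw [mem_ball]; linarith
  have hv1 : v ∈ ball (iot k u.fst) (2 * ρ) := by
    rw [mem_ball]
    have := dist_triangle v u (iot k u.fst)
    rw [dist_comm v u] at this
    linarith
  obtain ⟨hut, huN⟩ := hV _ hK hu1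
  obtain ⟨hvt, hvN⟩ := hV _ hK hv1
  have e1 : F (F.symm u) = u := F.right_inv hut
  have e2 : F (F.symm v) = v := F.right_inv hvt
  refine ⟨hut, hvt, ⟨?_, ?_, ?_⟩, huN⟩
  · exact (hF.neg _ (F.map_target hut)).1 (by rw [e1]; exact hu)
  · intro h
    have := (hF.neg _ (F.map_target hvt)).2 h
    rw [e2] at this
    linarith
  · refine lt_of_le_of_lt (hF.alip.dist_le_mul u hut v hvt) ?_
    rw [lt_div_iff₀ (by linarith)] at huv
    linarith

lemma exists_frontier {d : ℕ} {E : Set (Euc d)} {x y : Euc d} (hx : x ∈ E) (hy : y ∉ E) :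
    ∃ z ∈ frontier E, dist x z ≤ dist x y := by
  by_contra! h
  have hseg : ∀ z ∈ segment ℝ x y, dist x z ≤ dist x y := by
    intro z hz
    have := dist_add_dist_of_mem_segment hz
    have := dist_nonneg (x := z) (y := y)
    linarith
  have hsub : segment ℝ x y ⊆ interior E ∪ interior Eᶜ := by
    intro z hz
    by_contra hn
    have : z ∈ frontier E := by
      rw [← compl_frontier_eq_union_interior] at hn
      simpa using hn
    exact absurd (hseg z hz) (not_le.2 (h z this))
  rcases (convex_segment x y).isPreconnected.subset_or_subset isOpen_interior isOpen_interior
    ((disjoint_compl_right (a := E)).mono interior_subset interior_subset) hsub with h1 | h1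
  · exact hy (interior_subset (h1 (right_mem_segment ℝ x y)))
  · exact (interior_subset (h1 (left_mem_segment ℝ x y))) hx

structure CD (k : ℕ) (E : Set (Euc (k+1))) (lam : ℝ≥0) (n : ℕ)
    (F : Fin n → OpenPartialHomeomorph (Euc (k+1)) (QQ k)) (A W : Fin n → Set (Euc (k+1))) : Prop where
  chart : ∀ i, IsChart k E lam (F i)
  meas : ∀ i, MeasurableSet (A i)
  disj : Pairwise fun i j => Disjoint (A i) (A j)
  sub : ∀ i, A i ⊆ W i
  opn : ∀ i, IsOpen (W i)
  bdd : ∀ i, Bornology.IsBounded (W i)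
  cov : frontier E ⊆ ⋃ i, A i
  src : ∀ i, ∃ η > 0, ∀ x ∈ W i, ball x η ⊆ (F i).source

lemma exists_CD {k : ℕ} {E : Set (Euc (k+1))} (hE : BddC2Domain (k+1) E) {lam : ℝ≥0} (hl : 1 < lam) :
    ∃ n F A W, CD k E lam n F A W := by
  obtain ⟨f, hf, hEf, hfr, hdf⟩ := hE.defining
  have hcpt : IsCompact (frontier E) :=
    Metric.isCompact_of_isClosed_isBounded isClosed_frontier
      (hE.bounded.closure.subset frontier_subset_closure)
  have h1 : ∀ p ∈ frontier E, ∃ F : OpenPartialHomeomorph (Euc (k+1)) (QQ k), ∃ η > 0,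
      IsChart k E lam F ∧ ball p (2 * η) ⊆ F.source := by
    intro p hp
    obtain ⟨F, hpF, hF⟩ := exists_chart k hf hEf hfr (hdf p hp) hl
    obtain ⟨η, hη, hb⟩ := Metric.isOpen_iff.1 F.open_source p hpF
    exact ⟨F, η / 2, by positivity, hF, by rwa [mul_div_cancel₀ _ two_ne_zero]⟩
  choose F η hη hF hb using h1
  obtain ⟨t, ht⟩ := hcpt.elim_finite_subcover (fun p : frontier E => ball p.1 (η p.1 p.2))
    (fun _ => isOpen_ball) (fun p hp => mem_iUnion.2 ⟨⟨p, hp⟩, mem_ball_self (hη p hp)⟩)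
  let q : Fin t.card → frontier E := fun i => (t.equivFin.symm i).1
  let W : Fin t.card → Set (Euc (k+1)) := fun i => ball (q i).1 (η (q i).1 (q i).2)
  refine ⟨t.card, fun i => F (q i).1 (q i).2, fun i => W i \ ⋃ j, ⋃ (_ : j < i), W j, W, ?_⟩
  constructor
  · exact fun i => hF _ _
  · exact fun i => isOpen_ball.measurableSet.diff
      (MeasurableSet.iUnion fun j => MeasurableSet.iUnion fun _ => isOpen_ball.measurableSet)
  · intro i j hij
    rw [Set.disjoint_left]
    rintro x ⟨hx1, hx2⟩ ⟨hx3, hx4⟩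
    rcases lt_or_gt_of_ne hij with h | h
    · exact hx4 (mem_iUnion₂.2 ⟨i, h, hx1⟩)
    · exact hx2 (mem_iUnion₂.2 ⟨j, h, hx3⟩)
  · exact fun i => sdiff_subset
  · exact fun i => isOpen_ball
  · exact fun i => isBounded_ball
  · intro x hx
    obtain ⟨p, hpt, hp⟩ := mem_iUnion₂.1 (ht hx)
    have hne : ∃ i, x ∈ W i := ⟨t.equivFin ⟨p, hpt⟩, by simpa [W, q] using hp⟩
    obtain ⟨i, hi, hmin⟩ := WellFounded.has_min (wellFounded_lt (α := Fin t.card)) {i | x ∈ W i} hne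
    refine mem_iUnion.2 ⟨i, hi, ?_⟩
    intro h
    obtain ⟨j, hj, hxj⟩ := mem_iUnion₂.1 h
    exact hmin j hxj hj
  · intro i
    refine ⟨η (q i).1 (q i).2, hη _ _, fun x hx => ?_⟩
    refine Subset.trans (ball_subset_ball' ?_) (hb _ _)
    have := mem_ball.1 hx
    linarith

/-- flattened piece -/
def BB {k n : ℕ} (F : Fin n → OpenPartialHomeomorph (Euc (k+1)) (QQ k))
    (A : Fin n → Set (Euc (k+1))) (i : Fin n) : Set (Euc k) :=
  {u | iot k u ∈ (F i).target ∧ (F i).symm (iot k u) ∈ A i}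

section
variable {k : ℕ} {E : Set (Euc (k+1))} {lam : ℝ≥0} {n : ℕ}
    {F : Fin n → OpenPartialHomeomorph (Euc (k+1)) (QQ k)} {A W : Fin n → Set (Euc (k+1))}

lemma CD.Wsrc (h : CD k E lam n F A W) (i : Fin n) : W i ⊆ (F i).source := by
  obtain ⟨η, hη, hb⟩ := h.src i
  exact fun x hx => hb x hx (mem_ball_self hη)

lemma CD.Bmeas (h : CD k E lam n F A W) (i : Fin n) : MeasurableSet (BB F A i) := by
  classical
  have hm : Measurable ((F i).target.piecewise (F i).symm (fun _ => (0 : Euc (k+1)))) :=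
    ContinuousOn.measurable_piecewise (F i).continuousOn_symm continuousOn_const
      (F i).open_target.measurableSet
  have : BB F A i = iot k ⁻¹' ((F i).target ∩
      ((F i).target.piecewise (F i).symm (fun _ => (0 : Euc (k+1)))) ⁻¹' (A i)) := by
    ext u
    simp only [BB, mem_ofPred_eq, mem_preimage, mem_inter_iff]
    refine and_congr_right fun hu => ?_
    rw [Set.piecewise_eq_of_mem _ _ _ hu]
  rw [this]
  exact (iot_isom k).continuous.measurable ((F i).open_target.measurableSet.inter (hm (h.meas i)))

lemma CD.Btar (i : Fin n) : iot k '' BB F A i ⊆ (F i).target := by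
  rintro _ ⟨u, hu, rfl⟩
  exact hu.1

lemma eq_iot {w : QQ k} (hw : w.snd = 0) : iot k w.fst = w := by
  have : ‖iot k w.fst - w‖ ^ 2 = 0 := by
    rw [WithLp.prod_norm_sq_eq_of_L2]
    simp [iot, hw]
  simpa [sub_eq_zero] using this

lemma CD.Bim (h : CD k E lam n F A W) (i : Fin n) :
    (F i).symm '' (iot k '' BB F A i) = frontier E ∩ A i := by
  ext x
  constructor
  · rintro ⟨_, ⟨u, ⟨hu1, hu2⟩, rfl⟩, rfl⟩
    refine ⟨?_, hu2⟩
    rw [← (h.chart i).zero _ ((F i).map_target hu1), (F i).right_inv hu1]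
    rfl
  · rintro ⟨hx, hxA⟩
    have hs := h.Wsrc i (h.sub i hxA)
    have h0 := eq_iot (((h.chart i).zero x hs).2 hx)
    refine ⟨_, ⟨(F i x).fst, ⟨?_, ?_⟩, rfl⟩, ?_⟩
    · rw [h0]; exact (F i).map_source hs
    · rw [h0, (F i).left_inv hs]; exact hxA
    · rw [h0, (F i).left_inv hs]

lemma CD.Bfin (h : CD k E lam n F A W) (i : Fin n) : volume (BB F A i) < ∞ := by
  have h1 : Bornology.IsBounded (F i '' (W i)) := by
    obtain ⟨C, hC⟩ := Metric.isBounded_iff.1 (h.bdd i)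
    refine Metric.isBounded_iff.2 ⟨lam * C, ?_⟩
    rintro _ ⟨x, hx, rfl⟩ _ ⟨y, hy, rfl⟩
    refine ((h.chart i).lip.dist_le_mul x (h.Wsrc i hx) y (h.Wsrc i hy)).trans ?_
    exact mul_le_mul_of_nonneg_left (hC hx hy) lam.2
  have h2 : iot k '' BB F A i ⊆ F i '' W i := by
    rintro _ ⟨u, hu, rfl⟩
    exact ⟨_, h.sub i hu.2, (F i).right_inv hu.1⟩
  have h3 : Bornology.IsBounded (BB F A i) := by
    have := (iot_isom k).antilipschitz.isBounded_preimage (h1.subset h2)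
    exact this.subset (subset_preimage_image _ _)
  exact h3.measure_lt_top

lemma CD.sum (h : CD k E lam n F A W) :
    Hstd (k+1) k (frontier E) = ∑ i, Hstd (k+1) k ((F i).symm '' (iot k '' BB F A i)) := by
  have : frontier E = ⋃ i, (frontier E ∩ A i) := by
    rw [← inter_iUnion, inter_eq_self_of_subset_left h.cov]
  conv_lhs => rw [this]
  rw [measure_iUnion, tsum_fintype]
  · simp_rw [h.Bim]
  · intro i j hij
    exact (h.disj hij).mono inter_subset_right inter_subset_right
  · exact fun i => isClosed_frontier.measurableSet.inter (h.meas i)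

lemma CD.H_le (hk : 1 ≤ k) (h : CD k E lam n F A W) :
    Hstd (k+1) k (frontier E) ≤ (lam^k : ℝ≥0) * ∑ i, volume (BB F A i) := by
  rw [h.sum, Finset.mul_sum]
  exact Finset.sum_le_sum fun i _ => chart_C1 hk (h.chart i) (CD.Btar i)

lemma CD.le_H (hk : 1 ≤ k) (h : CD k E lam n F A W) :
    ∑ i, volume (BB F A i) ≤ (lam^k : ℝ≥0) * Hstd (k+1) k (frontier E) := by
  rw [h.sum, Finset.mul_sum]
  exact Finset.sum_le_sum fun i _ => chart_C2 hk (h.chart i) (CD.Btar i)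

lemma CD.H_fin (hk : 1 ≤ k) (h : CD k E lam n F A W) : Hstd (k+1) k (frontier E) < ∞ := by
  refine (h.H_le hk).trans_lt (ENNReal.mul_lt_top ENNReal.coe_lt_top ?_)
  exact ENNReal.sum_lt_top.2 fun i _ => h.Bfin i

end

/-- measure of pairs -/
noncomputable def MM {k : ℕ} (E : Set (Euc k)) (ρ : ℝ) : ℝ≥0∞ := (volume.prod volume) (PS E ρ)

lemma PS_meas {k : ℕ} {E : Set (Euc k)} (hE : MeasurableSet E) (ρ : ℝ) : MeasurableSet (PS E ρ) := by
  refine MeasurableSet.inter (measurable_fst hE) (MeasurableSet.inter (measurable_snd hE.compl) ?_)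
  exact measurableSet_lt (measurable_fst.dist measurable_snd) measurable_const

noncomputable def cc (k : ℕ) : ℝ≥0 := (omegaB k / (k+2)).toNNReal

lemma coe_cc (k : ℕ) : (cc k : ℝ≥0∞) = ENNReal.ofReal (omegaB k / (k+2)) := rfl

section
variable {k : ℕ} {E : Set (Euc (k+1))} {lam : ℝ≥0} {n : ℕ}
    {F : Fin n → OpenPartialHomeomorph (Euc (k+1)) (QQ k)} {A W : Fin n → Set (Euc (k+1))}

lemma ev_le {a : ℝ} (ha : 0 < a) : ∀ᶠ ρ in nhdsWithin (0:ℝ) (Ioi 0), 0 < ρ ∧ ρ < a := by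
  filter_upwards [Ioo_mem_nhdsGT ha] with ρ hρ using hρ

lemma CD.upper (h : CD k E lam n F A W) (hfr : IsCompact (frontier E)) (hl : 1 < lam)
    {δ : ℝ≥0∞} (hδ : δ ≠ 0) :
    ∀ᶠ ρ in nhdsWithin (0:ℝ) (Ioi 0), MM E ρ ≤ (lam^(k+1) : ℝ≥0) * (lam^(k+1) : ℝ≥0) *
      (cc k * ENNReal.ofReal ((lam * ρ)^(k+2)) * ∑ i, (volume (BB F A i) + δ)) := by
  have h1 : ∀ i, ∃ O, O ⊇ BB F A i ∧ IsOpen O ∧ volume O ≤ volume (BB F A i) + δ :=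
    fun i => Set.exists_isOpen_le_add _ _ hδ
  choose O hO1 hO2 hO3 using h1
  let V : Fin n → Set (Euc (k+1)) := fun i => W i ∩ (fun x => (F i x).fst) ⁻¹' (O i)
  have hVo : ∀ i, IsOpen (V i) := by
    intro i
    refine ContinuousOn.isOpen_inter_preimage ?_ (h.opn i) (hO2 i)
    have : Continuous fun u : QQ k => u.fst := (WithLp.prod_continuous_ofLp 2 (Euc k) ℝ).fst
    exact this.comp_continuousOn ((F i).continuousOn.mono (h.Wsrc i))
  have hcov : frontier E ⊆ ⋃ i, V i := by
    intro x hx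
    obtain ⟨i, hi⟩ := mem_iUnion.1 (h.cov hx)
    have hs := h.Wsrc i (h.sub i hi)
    have h0 := eq_iot (((h.chart i).zero x hs).2 hx)
    refine mem_iUnion.2 ⟨i, h.sub i hi, hO1 i ⟨?_, ?_⟩⟩
    · rw [h0]; exact (F i).map_source hs
    · rw [h0, (F i).left_inv hs]; exact hi
  obtain ⟨ρ0, hρ0, hth⟩ := hfr.exists_thickening_subset_open (isOpen_iUnion hVo) hcov
  have hη : ∀ᶠ ρ in nhdsWithin (0:ℝ) (Ioi 0), ∀ i, ∀ x ∈ W i, ball x ρ ⊆ (F i).source := by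
    refine eventually_all.2 fun i => ?_
    obtain ⟨η, hη, hb⟩ := h.src i
    filter_upwards [ev_le hη] with ρ hρ x hx
    exact (ball_subset_ball hρ.2.le).trans (hb x hx)
  filter_upwards [hη, ev_le hρ0] with ρ hρ1 hρ2
  have hlp : 0 < lam := zero_lt_one.trans hl
  have hsub : PS E ρ ⊆ ⋃ i, {p | p ∈ PS E ρ ∧ p.1 ∈ V i} := by
    intro p hp
    obtain ⟨z, hz, hd⟩ := exists_frontier hp.1 hp.2.1
    have : p.1 ∈ thickening ρ0 (frontier E) :=
      mem_thickening_iff.2 ⟨z, hz, hd.trans_lt (hp.2.2.trans hρ2.2)⟩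
    obtain ⟨i, hi⟩ := mem_iUnion.1 (hth this)
    exact mem_iUnion.2 ⟨i, hp, hi⟩
  refine (measure_mono hsub).trans ((measure_iUnion_fintype_le _ _).trans ?_)
  rw [Finset.mul_sum, Finset.mul_sum]
  refine Finset.sum_le_sum fun i _ => ?_
  refine (chart_up hlp (h.chart i) (O := O i) (fun x hx => ⟨hρ1 i x hx.1, hx.2⟩) hρ2.1).trans ?_
  rw [HS_vol k (hO2 i).measurableSet (mul_pos (by exact_mod_cast hlp) hρ2.1), ← coe_cc]
  gcongr
  exact hO3 i

lemma CD.lower (h : CD k E lam n F A W) (hE : IsOpen E) (hl : 1 < lam)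
    {δ : ℝ≥0∞} (hδ : δ ≠ 0) :
    ∀ᶠ ρ in nhdsWithin (0:ℝ) (Ioi 0),
      cc k * ENNReal.ofReal ((ρ / lam)^(k+2)) * ∑ i, volume (BB F A i) ≤
      (lam^(k+1) : ℝ≥0) * (lam^(k+1) : ℝ≥0) * MM E ρ +
      cc k * ENNReal.ofReal ((ρ / lam)^(k+2)) * (n * δ) := by
  have h1 : ∀ i, ∃ K, K ⊆ BB F A i ∧ IsCompact K ∧ volume (BB F A i) < volume K + δ :=
    fun i => (h.Bmeas i).exists_isCompact_lt_add (h.Bfin i).ne hδ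
  choose K hK1 hK2 hK3 using h1
  have hKt : ∀ i, iot k '' K i ⊆ (F i).target := fun i =>
    (image_mono (hK1 i)).trans (CD.Btar i)
  have hKc : ∀ i, IsCompact (iot k '' K i) := fun i => (hK2 i).image (iot_isom k).continuous
  let C : Fin n → Set (Euc (k+1)) := fun i => (F i).symm '' (iot k '' K i)
  have hC : ∀ i, IsCompact (C i) := fun i =>
    (hKc i).image_of_continuousOn ((F i).continuousOn_symm.mono (hKt i))
  have hCA : ∀ i, C i ⊆ A i := by
    rintro i _ ⟨_, ⟨u, hu, rfl⟩, rfl⟩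
    exact (hK1 i hu).2
  have hth : ∀ᶠ ε in nhdsWithin (0:ℝ) (Ioi 0), ∀ i j, i ≠ j →
      Disjoint (thickening ε (C i)) (thickening ε (C j)) := by
    refine eventually_all.2 fun i => eventually_all.2 fun j => ?_
    by_cases hij : i = j
    · exact Eventually.of_forall fun _ h => absurd hij h
    · obtain ⟨ε, hε, hd⟩ := ((h.disj hij).mono (hCA i) (hCA j)).exists_thickenings (hC i) (hC j).isClosed
      filter_upwards [ev_le hε] with ρ hρ _
      exact hd.mono (thickening_mono hρ.2.le _) (thickening_mono hρ.2.le _)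
  obtain ⟨ε, hε, hεpos⟩ := (hth.and self_mem_nhdsWithin).exists
  have hεpos : 0 < ε := hεpos
  let N : Fin n → Set (Euc (k+1)) := fun i => thickening ε (C i)
  have hN : ∀ᶠ ρ in nhdsWithin (0:ℝ) (Ioi 0), ∀ i, ∀ u ∈ K i,
      ball (iot k u) (2 * ρ) ⊆ (F i).target ∩ (F i).symm ⁻¹' (N i) := by
    refine eventually_all.2 fun i => ?_
    have ho : IsOpen ((F i).target ∩ (F i).symm ⁻¹' (N i)) :=
      (F i).continuousOn_symm.isOpen_inter_preimage (F i).open_target isOpen_thickening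
    have hs : iot k '' K i ⊆ (F i).target ∩ (F i).symm ⁻¹' (N i) := fun w hw =>
      ⟨hKt i hw, self_subset_thickening hεpos _ (mem_image_of_mem _ hw)⟩
    obtain ⟨ε', hε', hsub⟩ := (hKc i).exists_thickening_subset_open ho hs
    filter_upwards [ev_le (half_pos hε')] with ρ hρ u hu
    refine Subset.trans (ball_subset_ball (by linarith [hρ.2])) 
      ((ball_subset_thickening (mem_image_of_mem _ hu) ε').trans hsub)
  filter_upwards [hN, self_mem_nhdsWithin] with ρ hρN hρ
  have hρ : 0 < ρ := hρ
  have hlp : 0 < lam := zero_lt_one.trans hl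
  have hsum : ∑ i, (volume.prod volume) {p | p ∈ PS E ρ ∧ p.1 ∈ N i} ≤ MM E ρ := by
    have hmu := measure_iUnion (μ := (volume : Measure (Euc (k+1))).prod volume)
      (f := fun i => {p | p ∈ PS E ρ ∧ p.1 ∈ N i}) ?_ ?_
    · rw [tsum_fintype] at hmu
      rw [← hmu]
      refine measure_mono (iUnion_subset fun i p hp => hp.1)
    · intro i j hij
      rw [Function.onFun, Set.disjoint_left]
      rintro p ⟨_, hp⟩ ⟨_, hp2⟩
      exact Set.disjoint_left.1 (hε i j hij) hp hp2
    · exact fun i => (PS_meas hE.measurableSet ρ).inter (measurable_fst isOpen_thickening.measurableSet)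
  have hKB : ∑ i, volume (BB F A i) ≤ ∑ i, volume (K i) + n * δ := by
    calc _ ≤ ∑ i, (volume (K i) + δ) := Finset.sum_le_sum fun i _ => (hK3 i).le
      _ = _ := by simp [Finset.sum_add_distrib]
  refine (mul_le_mul_right hKB _).trans ?_
  rw [mul_add]
  refine add_le_add ?_ le_rfl
  refine le_trans ?_ (mul_le_mul_right hsum _)
  rw [Finset.mul_sum, Finset.mul_sum]
  refine Finset.sum_le_sum fun i _ => ?_
  refine le_trans (le_of_eq ?_) (chart_low hl.le (h.chart i) (hρN i) hρ)
  rw [HS_vol k (hK2 i).measurableSet (div_pos hρ (by exact_mod_cast hlp)), ← coe_cc]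
end

lemma MM_asym {k : ℕ} (hk : 1 ≤ k) {E : Set (Euc (k+1))} (hE : BddC2Domain (k+1) E) :
    ∃ L : ℝ≥0, (L : ℝ≥0∞) = cc k * Hstd (k+1) k (frontier E) ∧
      (∀ a : ℝ≥0, L < a → ∀ᶠ ρ in nhdsWithin (0:ℝ) (Ioi 0), MM E ρ ≤ a * ENNReal.ofReal (ρ^(k+2))) ∧
      (∀ a : ℝ≥0, a < L → ∀ᶠ ρ in nhdsWithin (0:ℝ) (Ioi 0), a * ENNReal.ofReal (ρ^(k+2)) ≤ MM E ρ) := by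
  have hcpt : IsCompact (frontier E) :=
    Metric.isCompact_of_isClosed_isBounded isClosed_frontier
      (hE.bounded.closure.subset frontier_subset_closure)
  have hHfin : Hstd (k+1) k (frontier E) ≠ ∞ := by
    obtain ⟨n, F, A, W, h⟩ := exists_CD hE (lam := 2) (by norm_num)
    exact (h.H_fin hk).ne
  lift Hstd (k+1) k (frontier E) to ℝ≥0 using hHfin with H hH
  have hne : ∀ (l : ℝ≥0), 1 < l → ∀ n : ℕ, ((l - 1) / (n+1) : ℝ≥0) ≠ 0 := by
    intro l hl n
    have : 0 < l - 1 := tsub_pos_of_lt hl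
    positivity
  have hnd : ∀ (l : ℝ≥0) (n : ℕ), (n : ℝ≥0∞) * (((l - 1) / (n+1) : ℝ≥0) : ℝ≥0∞) ≤ ((l - 1 : ℝ≥0) : ℝ≥0∞) := by
    intro l n
    norm_cast
    rw [mul_div_assoc', div_le_iff₀ (by positivity), mul_comm]
    gcongr
    push_cast
    exact le_self_add
  refine ⟨cc k * H, by push_cast; rfl, fun a ha => ?_, fun a ha => ?_⟩
  · let g : ℝ≥0 → ℝ≥0 := fun l => l^(k+1)*l^(k+1)*(cc k*l^(k+2)*(l^k*H + (l-1)))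
    have hg : Continuous g := by fun_prop
    have hg1 : g 1 < a := by simpa [g] using ha
    have hev : ∀ᶠ l in nhdsWithin (1:ℝ≥0) (Ioi 1), g l < a :=
      nhdsWithin_le_nhds (hg.tendsto 1 (Iio_mem_nhds hg1))
    obtain ⟨l, hla, hl⟩ := (hev.and self_mem_nhdsWithin).exists
    have hl : 1 < l := hl
    obtain ⟨n, F, A, W, h⟩ := exists_CD hE hl
    have hle := h.le_H hk
    rw [← hH] at hle
    filter_upwards [h.upper hcpt hl (δ := ((l - 1) / (n+1) : ℝ≥0)) (by exact_mod_cast hne l hl n),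
      self_mem_nhdsWithin] with ρ hρ hρ0
    have hρ0 : 0 < ρ := hρ0
    refine hρ.trans ?_
    have hs : ∑ i, (volume (BB F A i) + (((l - 1) / (n+1) : ℝ≥0) : ℝ≥0∞)) ≤ ((l^k*H + (l-1) : ℝ≥0) : ℝ≥0∞) := by
      rw [Finset.sum_add_distrib]
      simp only [Finset.sum_const, Finset.card_univ, Fintype.card_fin, nsmul_eq_mul]
      rw [ENNReal.coe_add, ENNReal.coe_mul]
      exact add_le_add hle (hnd l n)
    have hp : ENNReal.ofReal ((l * ρ)^(k+2)) = ((l^(k+2) : ℝ≥0) : ℝ≥0∞) * ENNReal.ofReal (ρ^(k+2)) := by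
      rw [mul_pow, ENNReal.ofReal_mul (by positivity), ← NNReal.coe_pow, ENNReal.ofReal_coe_nnreal]
    calc _ ≤ (l^(k+1) : ℝ≥0) * (l^(k+1) : ℝ≥0) *
      (cc k * ENNReal.ofReal ((l * ρ)^(k+2)) * ((l^k*H + (l-1) : ℝ≥0) : ℝ≥0∞)) := by gcongr
      _ = (g l : ℝ≥0∞) * ENNReal.ofReal (ρ^(k+2)) := by
        rw [hp]; simp only [g, ENNReal.coe_mul]; ring
      _ ≤ _ := by gcongr
  · let g : ℝ≥0 → ℝ≥0 := fun l => l^k*(l^(k+2)*(l^(k+1)*l^(k+1))*a + cc k*(l-1))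
    have hg : Continuous g := by fun_prop
    have hg1 : g 1 < cc k * H := by simpa [g] using ha
    have hev : ∀ᶠ l in nhdsWithin (1:ℝ≥0) (Ioi 1), g l < cc k * H :=
      nhdsWithin_le_nhds (hg.tendsto 1 (Iio_mem_nhds hg1))
    obtain ⟨l, hla, hl⟩ := (hev.and self_mem_nhdsWithin).exists
    have hl : 1 < l := hl
    have hl0 : 0 < l := zero_lt_one.trans hl
    obtain ⟨n, F, A, W, h⟩ := exists_CD hE hl
    have hle := h.H_le hk
    rw [← hH] at hle
    filter_upwards [h.lower hE.isOpen hl (δ := ((l - 1) / (n+1) : ℝ≥0)) (by exact_mod_cast hne l hl n),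
      self_mem_nhdsWithin] with ρ hρ hρ0
    have hρ0 : 0 < ρ := hρ0
    by_contra! hcon
    set R : ℝ≥0 := (ρ^(k+2)).toNNReal with hR
    have hRpos : 0 < R := by rw [hR]; exact Real.toNNReal_pos.2 (by positivity)
    have hRe : ENNReal.ofReal (ρ^(k+2)) = R := rfl
    have hp : ((l^(k+2) : ℝ≥0) : ℝ≥0∞) * ENNReal.ofReal ((ρ / l)^(k+2)) = R := by
      rw [← hRe, ← ENNReal.ofReal_coe_nnreal, ← ENNReal.ofReal_mul (by positivity)]
      congr 1
      push_cast
      rw [← mul_pow, mul_div_cancel₀ _ (by exact_mod_cast hl0.ne')]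
    have key : ((cc k * H : ℝ≥0) : ℝ≥0∞) * R ≤ (g l : ℝ≥0) * R := by
      calc ((cc k * H : ℝ≥0) : ℝ≥0∞) * R ≤ cc k * ((l^k : ℝ≥0) * ∑ i, volume (BB F A i)) * R := by
            rw [ENNReal.coe_mul]; gcongr
        _ = (l^k : ℝ≥0) * ((l^(k+2) : ℝ≥0) * (cc k * ENNReal.ofReal ((ρ / l)^(k+2)) * ∑ i, volume (BB F A i))) := by
            rw [← hp]; ring
        _ ≤ (l^k : ℝ≥0) * ((l^(k+2) : ℝ≥0) * ((l^(k+1) : ℝ≥0) * (l^(k+1) : ℝ≥0) * MM E ρ +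
              cc k * ENNReal.ofReal ((ρ / l)^(k+2)) * (n * ((l - 1) / (n+1) : ℝ≥0)))) := by gcongr
        _ ≤ (l^k : ℝ≥0) * ((l^(k+2) : ℝ≥0) * ((l^(k+1) : ℝ≥0) * (l^(k+1) : ℝ≥0) * (a * R) +
              cc k * ENNReal.ofReal ((ρ / l)^(k+2)) * (l - 1 : ℝ≥0))) := by
            gcongr
            · exact hcon.le
            · exact hnd l n
        _ = (l^k : ℝ≥0) * ((l^(k+2) : ℝ≥0) * ((l^(k+1) : ℝ≥0) * (l^(k+1) : ℝ≥0)) * (a * R) +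
              cc k * ((l^(k+2) : ℝ≥0) * ENNReal.ofReal ((ρ / l)^(k+2))) * (l - 1 : ℝ≥0)) := by ring
        _ = (g l : ℝ≥0) * R := by
            rw [hp]; simp only [g, ENNReal.coe_mul, ENNReal.coe_add]; ring
    have key2 : cc k * H * R ≤ g l * R := by exact_mod_cast key
    exact absurd (le_of_mul_le_mul_right key2 hRpos) (not_le.2 hla)

noncomputable def wt (D ρ : ℝ) : ℝ≥0∞ := ENNReal.ofReal (D * ρ ^ (-D - 1))

lemma wt_meas (D : ℝ) : Measurable (wt D) := by
  unfold wt; fun_prop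

lemma lint_tail {p c : ℝ} (hp : 0 < p) (hc : 0 < c) :
    ∫⁻ ρ in Ioi c, ENNReal.ofReal (ρ ^ (-p - 1)) = ENNReal.ofReal (c ^ (-p) / p) := by
  rw [← ofReal_integral_eq_lintegral_ofReal]
  · rw [integral_Ioi_rpow_of_lt (by linarith) hc]
    congr 1
    rw [show -p - 1 + 1 = -p by ring]
    field_simp
  · exact integrableOn_Ioi_rpow_of_lt (by linarith) hc
  · filter_upwards [ae_restrict_mem measurableSet_Ioi] with ρ hρ
    exact Real.rpow_nonneg (hc.le.trans (le_of_lt hρ)) _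

lemma lint_wt {D c : ℝ} (hD : 0 < D) (hc : 0 < c) :
    ∫⁻ ρ in Ioi c, wt D ρ = ENNReal.ofReal (c ^ (-D)) := by
  unfold wt
  simp_rw [ENNReal.ofReal_mul hD.le]
  rw [lintegral_const_mul _ (by fun_prop), lint_tail hD hc, ← ENNReal.ofReal_mul hD.le]
  congr 1
  field_simp

lemma ker_eq (d : ℕ) {s r t : ℝ} (hs : 1 < s) (hr : 0 < r) :
    ENNReal.ofReal (ker d s r t) = ∫⁻ ρ in Ioi r, (Ioi t).indicator (wt (d+s)) ρ := by
  rw [lintegral_indicator measurableSet_Ioi, Measure.restrict_restrict measurableSet_Ioi,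
    Ioi_inter_Ioi, lint_wt (by positivity) (lt_sup_of_lt_right hr)]
  congr 1
  unfold _root_.ker
  split_ifs with h
  · rw [sup_eq_right.2 h]
  · rw [sup_eq_left.2 (not_le.1 h).le]

lemma Jt_eq (d : ℕ) {s r : ℝ} (hs : 1 < s) (hr : 0 < r) {E : Set (Euc d)} (hE : MeasurableSet E) :
    Jt d s r E = ∫⁻ ρ in Ioi r, wt (d+s) ρ * MM E ρ := by
  unfold Jt
  simp_rw [ker_eq d hs hr]
  let g : (Euc d × Euc d) × ℝ → ℝ≥0∞ := fun q =>
    {q : (Euc d × Euc d) × ℝ | dist q.1.1 q.1.2 < q.2}.indicator (fun q => wt (d+s) q.2) q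
  have hS : MeasurableSet {q : (Euc d × Euc d) × ℝ | dist q.1.1 q.1.2 < q.2} :=
    measurableSet_lt (by fun_prop) (by fun_prop)
  have hg : Measurable g := ((wt_meas _).comp measurable_snd).indicator hS
  have h1 : ∀ x y : Euc d, ∀ ρ, (Ioi (dist x y)).indicator (wt (d+s)) ρ = g ((x,y),ρ) := fun x y ρ => rfl
  simp_rw [h1]
  have h2 : Measurable fun p : Euc d × Euc d => ∫⁻ ρ in Ioi r, g (p, ρ) :=
    hg.lintegral_prod_right'
  have h3 := lintegral_prod (μ := volume.restrict E) (ν := volume.restrict Eᶜ)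
    (fun p : Euc d × Euc d => ∫⁻ ρ in Ioi r, g (p, ρ)) h2.aemeasurable
  rw [← h3, lintegral_lintegral_swap hg.aemeasurable]
  refine lintegral_congr fun ρ => ?_
  have hS' : MeasurableSet {p : Euc d × Euc d | dist p.1 p.2 < ρ} :=
    measurableSet_lt (by fun_prop) (by fun_prop)
  have h4 : ∀ p : Euc d × Euc d, g (p, ρ) =
      {p : Euc d × Euc d | dist p.1 p.2 < ρ}.indicator (fun _ => wt (d+s) ρ) p := fun p => rfl
  simp_rw [h4]
  rw [lintegral_indicator_const hS', Measure.prod_restrict, Measure.restrict_apply hS']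
  unfold MM PS
  congr 2
  ext p
  constructor
  · rintro ⟨h1, h2, h3⟩; exact ⟨h2, h3, h1⟩
  · rintro ⟨h1, h2, h3⟩; exact ⟨h3, h1, h2⟩

lemma MM_le {d : ℕ} {E : Set (Euc d)} (hE : MeasurableSet E) {ρ : ℝ} (hρ : 0 < ρ) :
    MM E ρ ≤ volume E * volume (ball (0 : Euc d) 1) * ENNReal.ofReal (ρ ^ d) := by
  unfold MM
  rw [Measure.prod_apply (PS_meas hE ρ)]
  calc _ ≤ ∫⁻ x, E.indicator (fun _ => ENNReal.ofReal (ρ ^ d) * volume (ball (0 : Euc d) 1)) x := by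
        refine lintegral_mono fun x => ?_
        by_cases hx : x ∈ E
        · rw [indicator_of_mem hx]
          refine (measure_mono (t := ball x ρ) ?_).trans (le_of_eq ?_)
          · rintro y ⟨_, _, h⟩
            rw [mem_ball, dist_comm]; exact h
          · rw [Measure.addHaar_ball_of_pos _ _ hρ]; simp
        · rw [indicator_of_notMem hx]
          refine le_of_eq ?_
          convert measure_empty (μ := (volume : Measure (Euc d)))
          ext y
          simp [PS, hx]
    _ = _ := by rw [lintegral_indicator_const hE]; ring

lemma lint_mid (d : ℕ) {s r δ : ℝ} (hs : 1 < s) (hr : 0 < r) (hrd : r ≤ δ) (a : ℝ≥0) :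
    ∫⁻ ρ in Ioc r δ, wt (d+s) ρ * (a * ENNReal.ofReal (ρ ^ (d+1))) =
      a * ENNReal.ofReal ((d+s) * ((r^(1-s) - δ^(1-s)) / (s-1))) := by
  have h1 : ∀ ρ ∈ Ioc r δ, wt (d+s) ρ * (a * ENNReal.ofReal (ρ ^ (d+1))) =
      a * (ENNReal.ofReal (d+s) * ENNReal.ofReal (ρ ^ (-s))) := by
    intro ρ hρ
    have h0 : 0 < ρ := hr.trans hρ.1
    unfold wt
    rw [mul_left_comm, ← ENNReal.ofReal_mul (by positivity), ← ENNReal.ofReal_mul (by positivity),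
      mul_assoc, ← Real.rpow_natCast, ← Real.rpow_add h0]
    congr 4
    push_cast; ring
  rw [setLIntegral_congr_fun measurableSet_Ioc h1, lintegral_const_mul _ (by fun_prop),
    lintegral_const_mul _ (by fun_prop), ← ofReal_integral_eq_lintegral_ofReal, 
    ← intervalIntegral.integral_of_le hrd, integral_rpow, ← ENNReal.ofReal_mul (by positivity)]
  · congr 3
    have : s - 1 ≠ 0 := by linarith
    have : -s + 1 ≠ 0 := by intro h; apply this; linarith
    rw [show -s + 1 = 1 - s by ring] at *
    field_simp
    ring
  · right
    refine ⟨by linarith, ?_⟩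
    rw [uIcc_of_le hrd]
    exact fun h => absurd h.1 (not_le.2 hr)
  · have := intervalIntegral.intervalIntegrable_rpow (μ := volume) (a := r) (b := δ) (r := -s) (Or.inr (by
      rw [uIcc_of_le hrd]
      exact fun h => absurd h.1 (not_le.2 hr)))
    rwa [intervalIntegrable_iff_integrableOn_Ioc_of_le hrd] at this
  · filter_upwards [ae_restrict_mem measurableSet_Ioc] with ρ hρ
    exact Real.rpow_nonneg (hr.le.trans (le_of_lt hρ.1)) _

lemma J_low (d : ℕ) {s r δ : ℝ} (hs : 1 < s) (hr : 0 < r) (hrd : r ≤ δ) {E : Set (Euc d)}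
    (hE : MeasurableSet E) (a : ℝ≥0)
    (hM : ∀ ρ, 0 < ρ → ρ ≤ δ → a * ENNReal.ofReal (ρ^(d+1)) ≤ MM E ρ) :
    a * ENNReal.ofReal ((d+s) * ((r^(1-s) - δ^(1-s)) / (s-1))) ≤ Jt d s r E := by
  rw [Jt_eq d hs hr hE, ← lint_mid d hs hr hrd a]
  refine le_trans ?_ (lintegral_mono_set (s := Ioc r δ) Ioc_subset_Ioi_self)
  refine setLIntegral_mono' measurableSet_Ioc fun ρ hρ => ?_
  gcongr
  exact hM ρ (hr.trans hρ.1) hρ.2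

lemma J_up (d : ℕ) {s r δ : ℝ} (hs : 1 < s) (hr : 0 < r) (hrd : r ≤ δ) {E : Set (Euc d)}
    (hE : MeasurableSet E) (a : ℝ≥0)
    (hM : ∀ ρ, 0 < ρ → ρ ≤ δ → MM E ρ ≤ a * ENNReal.ofReal (ρ^(d+1))) :
    Jt d s r E ≤ a * ENNReal.ofReal ((d+s) * ((r^(1-s) - δ^(1-s)) / (s-1))) +
      volume E * volume (ball (0 : Euc d) 1) * ENNReal.ofReal ((d+s) * (δ^(-s) / s)) := by
  have hδ : 0 < δ := hr.trans_le hrd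
  rw [Jt_eq d hs hr hE, ← lint_mid d hs hr hrd a, ← Ioc_union_Ioi_eq_Ioi hrd]
  refine (lintegral_union_le _ _ _).trans (add_le_add ?_ ?_)
  · refine setLIntegral_mono' measurableSet_Ioc fun ρ hρ => ?_
    gcongr
    exact hM ρ (hr.trans hρ.1) hρ.2
  · rw [ENNReal.ofReal_mul (by positivity), ← lint_tail (by linarith) hδ, ← lintegral_const_mul _ (by fun_prop),
      ← lintegral_const_mul _ (by fun_prop)]
    refine setLIntegral_mono' measurableSet_Ioi fun ρ hρ => ?_
    have h0 : 0 < ρ := hδ.trans hρ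
    refine (mul_le_mul_right (MM_le hE h0) _).trans (le_of_eq ?_)
    unfold wt
    rw [mul_left_comm, ← ENNReal.ofReal_mul (by positivity), ← ENNReal.ofReal_mul (by positivity),
      mul_assoc (_ + _), ← Real.rpow_natCast, ← Real.rpow_add h0]
    congr 4
    ring

lemma quot_tend {Z : ℕ → ℝ} (hZ : Tendsto Z atTop atTop) (a b : ℝ) :
    Tendsto (fun n => (a * Z n + b) / (Z n + 1)) atTop (nhds a) := by
  have h1 : Tendsto (fun n => Z n + 1) atTop atTop := tendsto_atTop_add_const_right _ _ hZ
  have h2 : Tendsto (fun n => a + (b - a) * (Z n + 1)⁻¹) atTop (nhds (a + (b - a) * 0)) :=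
    (h1.inv_tendsto_atTop.const_mul _).const_add _
  rw [mul_zero, add_zero] at h2
  refine h2.congr' ?_
  filter_upwards [h1.eventually_gt_atTop 0] with n hn
  field_simp
  ring

lemma A_ge {s r : ℝ} (hs : 1 < s) (hr : 0 < r) : -Real.log r ≤ (r^(1-s) - 1)/(s-1) := by
  rw [le_div_iff₀ (by linarith), Real.rpow_def_of_pos hr]
  have := Real.add_one_le_exp (Real.log r * (1 - s))
  linarith

lemma A_le {s r : ℝ} (hs : 1 < s) (hs2 : s < 2) (hr : 0 < r) (hr1 : r < 1) :
    (r^(1-s) - 1)/(s-1) ≤ -Real.log r * Real.exp (-Real.log r) := by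
  have hl : 0 < -Real.log r := by linarith [Real.log_neg hr hr1]
  rw [div_le_iff₀ (by linarith), Real.rpow_def_of_pos hr]
  set x := Real.log r * (1 - s) with hx
  have h1 := Real.add_one_le_exp (-x)
  have h2 : Real.exp x * Real.exp (-x) = 1 := by rw [← Real.exp_add]; simp
  have h3 : Real.exp x - 1 ≤ x * Real.exp x := by
    have := mul_le_mul_of_nonneg_left h1 (Real.exp_pos x).le
    linarith
  have h4 : x ≤ -Real.log r := by
    have : 0 ≤ (-Real.log r) * (2 - s) := mul_nonneg hl.le (by linarith)
    rw [hx]; linarith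
  have h5 : 0 ≤ x := by
    have : 0 ≤ (-Real.log r) * (s - 1) := mul_nonneg hl.le (by linarith)
    rw [hx]; linarith
  calc _ ≤ x * Real.exp x := h3
    _ ≤ x * Real.exp (-Real.log r) := by gcongr
    _ = _ := by rw [hx]; ring

lemma ev_exists {P : ℝ → Prop} (h : ∀ᶠ ρ in nhdsWithin (0:ℝ) (Ioi 0), P ρ) :
    ∃ δ, 0 < δ ∧ δ < 1 ∧ ∀ ρ, 0 < ρ → ρ ≤ δ → P ρ := by
  obtain ⟨ε, hε, hs⟩ := mem_nhdsGT_iff_exists_Ioc_subset.1 h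
  have hε : 0 < ε := hε
  refine ⟨min ε (1/2), by positivity, (min_le_right _ _).trans_lt (by norm_num), fun ρ h0 h1 => ?_⟩
  exact hs ⟨h0, h1.trans (min_le_left _ _)⟩

theorem main_tend (d : ℕ)
    (r : ℕ → ℝ) (hr : ∀ n, r n ∈ Set.Ioo (0 : ℝ) 1) (hr0 : Tendsto r atTop (nhds 0))
    (s : ℕ → ℝ) (hs : ∀ n, 1 < s n) (hs1 : Tendsto s atTop (nhds 1))
    (E : Set (Euc d)) (hE : MeasurableSet E) (hEf : volume E ≠ ∞) (L : ℝ≥0)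
    (hup : ∀ a : ℝ≥0, L < a → ∀ᶠ ρ in nhdsWithin (0:ℝ) (Ioi 0), MM E ρ ≤ a * ENNReal.ofReal (ρ^(d+1)))
    (hlo : ∀ a : ℝ≥0, a < L → ∀ᶠ ρ in nhdsWithin (0:ℝ) (Ioi 0), a * ENNReal.ofReal (ρ^(d+1)) ≤ MM E ρ) :
    Tendsto (fun n => Jt d (s n) (r n) E / ENNReal.ofReal (betaScale d (s n) (r n)))
      atTop (nhds (((d+1) * L : ℝ≥0) : ℝ≥0∞)) := by
  set Z : ℕ → ℝ := fun n => ((d:ℝ) + s n) * ((r n ^ (1 - s n) - 1) / (s n - 1)) with hZdef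
  have hlog : Tendsto (fun n => -Real.log (r n)) atTop atTop := by
    refine tendsto_neg_atBot_atTop.comp (Real.tendsto_log_nhdsGT_zero.comp ?_)
    exact tendsto_nhdsWithin_iff.2 ⟨hr0, Eventually.of_forall fun n => (hr n).1⟩
  have hZge : ∀ n, -Real.log (r n) ≤ Z n := by
    intro n
    have h1 := A_ge (hs n) (hr n).1
    have h2 : 0 < -Real.log (r n) := by linarith [Real.log_neg (hr n).1 (hr n).2]
    have h3 : (1:ℝ) ≤ d + s n := by
      have : (0:ℝ) ≤ d := by positivity
      linarith [hs n]
    calc _ ≤ (r n ^ (1 - s n) - 1) / (s n - 1) := h1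
      _ ≤ _ := le_mul_of_one_le_left (by linarith) h3
  have hZ : Tendsto Z atTop atTop := tendsto_atTop_mono hZge hlog
  have hZ0 : ∀ n, 0 < Z n := fun n => by linarith [hZge n, Real.log_neg (hr n).1 (hr n).2]
  have hβ : ∀ n, betaScale d (s n) (r n) = (Z n + 1) / (d + 1) := by
    intro n
    simp only [betaScale, hZdef]
    field_simp
  have hd1 : (0:ℝ) < d + 1 := by positivity
  have hβ0 : ∀ n, 0 < betaScale d (s n) (r n) := fun n => by
    rw [hβ]; exact div_pos (by linarith [hZ0 n]) hd1
  have hs2 : ∀ᶠ n in atTop, s n < 2 := hs1.eventually_lt_const (by norm_num)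
  refine tendsto_order.2 ⟨fun b hb => ?_, fun b hb => ?_⟩
  · lift b to ℝ≥0 using hb.ne_top
    have hb : b < (d+1) * L := by exact_mod_cast hb
    have : b / (d+1) < L := by rw [div_lt_iff₀' (by positivity)]; exact hb
    obtain ⟨a, ha1, ha2⟩ := exists_between this
    rw [div_lt_iff₀' (by positivity)] at ha1
    obtain ⟨δ, hδ, hδ1, hM⟩ := ev_exists (hlo a ha2)
    set K : ℝ := -Real.log δ * Real.exp (-Real.log δ) with hK
    have hlδ : 0 < -Real.log δ := by linarith [Real.log_neg hδ hδ1]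
    have hK0 : 0 < K := by positivity
    have ht := quot_tend hZ ((d+1) * a) (-((d+1) * a * ((d + 2) * K)))
    have ha1' : (b:ℝ) < (d+1) * a := by exact_mod_cast ha1
    filter_upwards [ht.eventually_const_lt ha1', hs2, hr0.eventually_lt_const hδ] with n hn hn2 hn3
    have hJ := J_low d (hs n) (hr n).1 hn3.le hE a hM
    rw [ENNReal.lt_div_iff_mul_lt (Or.inl (by simpa using hβ0 n)) (Or.inl ENNReal.ofReal_ne_top)]
    refine lt_of_lt_of_le ?_ hJ
    rw [← ENNReal.ofReal_coe_nnreal, ← ENNReal.ofReal_coe_nnreal (p := a), ← ENNReal.ofReal_mul (by positivity),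
      ← ENNReal.ofReal_mul (by positivity)]
    have hA := A_le (hs n) hn2 hδ hδ1
    have hZn : ((d:ℝ) + s n) * ((r n ^ (1 - s n) - δ ^ (1 - s n)) / (s n - 1)) =
      Z n - (d + s n) * ((δ ^ (1 - s n) - 1) / (s n - 1)) := by
      simp only [hZdef]; ring
    have hge : Z n - (d + 2) * K ≤ Z n - (d + s n) * ((δ ^ (1 - s n) - 1) / (s n - 1)) := by
      have h1 : (d + s n) * ((δ ^ (1 - s n) - 1) / (s n - 1)) ≤ (d + s n) * K :=
        mul_le_mul_of_nonneg_left hA (by have := hs n; positivity)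
      have h2 : (d + s n) * K ≤ (d + 2) * K := mul_le_mul_of_nonneg_right (by linarith) hK0.le
      linarith
    rw [hZn, hβ]
    have hreal : (b:ℝ) * ((Z n + 1) / (d + 1)) < a * (Z n - (d + s n) * ((δ ^ (1 - s n) - 1) / (s n - 1))) := by
      refine lt_of_lt_of_le ?_ (mul_le_mul_of_nonneg_left hge a.2)
      rw [lt_div_iff₀ (by linarith [hZ0 n])] at hn
      rw [mul_div_assoc', div_lt_iff₀ hd1]
      change (b:ℝ) * (Z n + 1) < (a:ℝ) * (Z n - (d + 2) * K) * (d + 1)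
      linarith
    refine (ENNReal.ofReal_lt_ofReal_iff_of_nonneg ?_).2 hreal
    exact mul_nonneg b.2 (div_nonneg (by linarith [hZ0 n]) hd1.le)
  · obtain ⟨b', hb1, hb2⟩ := ENNReal.lt_iff_exists_nnreal_btwn.1 hb
    have hb1 : (d+1) * L < b' := by exact_mod_cast hb1
    have : L < b' / (d+1) := by rw [lt_div_iff₀' (by positivity)]; exact hb1
    obtain ⟨a, ha1, ha2⟩ := exists_between this
    rw [lt_div_iff₀' (by positivity)] at ha2
    obtain ⟨δ, hδ, hδ1, hM⟩ := ev_exists (hup a ha1)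
    have hVf : volume E * volume (ball (0 : Euc d) 1) ≠ ∞ := ENNReal.mul_ne_top hEf measure_ball_lt_top.ne
    lift volume E * volume (ball (0 : Euc d) 1) to ℝ≥0 using hVf with V0 hV0
    set K : ℝ := V0 * ((d+2) * δ^(-2:ℝ)) with hK
    have hK0 : 0 ≤ K := by positivity
    have ht := quot_tend hZ ((d+1) * a) ((d+1) * K)
    have ha2' : (d+1) * (a:ℝ) < b' := by exact_mod_cast ha2
    filter_upwards [ht.eventually_lt_const ha2', hs2, hr0.eventually_lt_const hδ] with n hn hn2 hn3
    have hJ := J_up d (hs n) (hr n).1 hn3.le hE a hM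
    rw [← hV0] at hJ
    refine lt_of_le_of_lt ?_ hb2
    refine ENNReal.div_le_of_le_mul (hJ.trans ?_)
    have hsn := hs n
    rw [← ENNReal.ofReal_coe_nnreal, ← ENNReal.ofReal_coe_nnreal (p := V0), ← ENNReal.ofReal_coe_nnreal (p := b'),
      ← ENNReal.ofReal_mul (by positivity),
      ← ENNReal.ofReal_mul (by positivity), ← ENNReal.ofReal_mul (by positivity)]
    have hA : 0 ≤ (δ ^ (1 - s n) - 1) / (s n - 1) :=
      le_trans (by linarith [Real.log_neg hδ hδ1]) (A_ge (hs n) hδ)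
    have hZn : ((d:ℝ) + s n) * ((r n ^ (1 - s n) - δ ^ (1 - s n)) / (s n - 1)) =
      Z n - (d + s n) * ((δ ^ (1 - s n) - 1) / (s n - 1)) := by
      simp only [hZdef]; ring
    have hmono : ((d:ℝ) + s n) * ((r n ^ (1 - s n) - δ ^ (1 - s n)) / (s n - 1)) ≤ Z n := by
      rw [hZn]
      have : 0 ≤ (d + s n) * ((δ ^ (1 - s n) - 1) / (s n - 1)) := mul_nonneg (by positivity) hA
      linarith
    have htail : (V0:ℝ) * ((d + s n) * (δ^(-s n) / s n)) ≤ K := by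
      have h1 : δ ^ (-s n) ≤ δ ^ (-2:ℝ) := Real.rpow_le_rpow_of_exponent_ge hδ hδ1.le (by linarith)
      have h2 : δ ^ (-s n) / s n ≤ δ ^ (-s n) := div_le_self (by positivity) hsn.le
      rw [hK]
      gcongr
      exact h2.trans h1
    have htot : (a:ℝ) * Z n + K ≤ b' * betaScale d (s n) (r n) := by
      rw [hβ]
      rw [div_lt_iff₀ (by linarith [hZ0 n])] at hn
      rw [mul_div_assoc', le_div_iff₀ hd1]
      linarith
    calc _ ≤ ENNReal.ofReal (a * Z n) + ENNReal.ofReal K := by gcongr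
      _ = ENNReal.ofReal (a * Z n + K) := (ENNReal.ofReal_add (mul_nonneg a.2 (hZ0 n).le) hK0).symm
      _ ≤ _ := ENNReal.ofReal_le_ofReal htot

/-- For a bounded open set `E` with compact `C²` boundary and simultaneous
limits `r_n → 0⁺`, `s_n → 1⁺`, `J̃^{s_n}_{r_n}(E)/β(r_n,s_n) → ω_{d-1}·H^{d-1}(∂E)`. -/
theorem stmt18 (d : ℕ) (hd : 2 ≤ d)
    (r : ℕ → ℝ) (hr : ∀ n, r n ∈ Set.Ioo (0 : ℝ) 1) (hr0 : Tendsto r atTop (nhds 0))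
    (s : ℕ → ℝ) (hs : ∀ n, 1 < s n) (hs1 : Tendsto s atTop (nhds 1))
    (E : Set (Euc d)) (hE : BddC2Domain d E) :
    Tendsto (fun n => Jt d (s n) (r n) E / ENNReal.ofReal (betaScale d (s n) (r n)))
      atTop
      (nhds (ENNReal.ofReal (omegaB (d - 1)) * Hstd d (d - 1) (frontier E))) := by
  obtain ⟨k, rfl⟩ : ∃ k, d = k + 1 := ⟨d - 1, by omega⟩
  obtain ⟨L, hL, hup, hlo⟩ := MM_asym (k := k) (by omega) hE
  have h := main_tend (k+1) r hr hr0 s hs hs1 E hE.isOpen.measurableSet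
    hE.bounded.measure_lt_top.ne L hup hlo
  convert h using 2
  rw [ENNReal.coe_mul, hL, coe_cc, ← mul_assoc, add_tsub_cancel_right]
  congr 1
  rw [← ENNReal.ofReal_coe_nnreal, ← ENNReal.ofReal_mul (by positivity)]
  congr 1
  push_cast
  field_simp
  ring

end
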